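/- arXiv:1911.06778 — 2 statements merged into one kernel-verified Lean document; each statement's English description precedes it below -/
import Mathlib

section
/- Under condition [A], the moderate deviation principle holds: if a sequence κ = κ_n ∈ ℝ satisfies lim_{n→∞} κ/n = 0 and lim_{n→∞} κ/√n = ∞, then the sequence of random variables R̃(n) := (R(n) − an)/κ satisfies the large deviation principle with normalizing function φ(n) := κ²/n and rate function I(y) := y²/(2σ²). -/
noncomputable section

/-- A chain with unbounded variable length memory over the binary alphabet `{0,1}`,
with memory parameter `v ≥ 1`.  For `k ∈ ℕ ∪ {0}` (the distance from the current
position to the nearest `1`) and a word `w` of `v - 1` letters (the letters standing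
to the left of that `1`), `p k w` is the probability of appending the character `1`.
The structure records the sample space, the appended characters `X n = r_n(n)`,
the full configuration `cfg`, the position `mpos ω n` of the rightmost `1` among the
coordinates `≤ n`, and the Markov transition rule `htrans`. -/
structure VLMC (v : ℕ) (p : ℕ → (Fin (v - 1) → Bool) → ℝ) where
  /-- the sample space -/
  Ω : Type
  [mΩ : MeasurableSpace Ω]
  /-- the underlying probability measure -/
  P : MeasureTheory.Measure Ω
  hprob : MeasureTheory.IsProbabilityMeasure P
  hv : 0 < v
  /-- the (fixed) initial configuration; only the coordinates `i ≤ 0` are relevant -/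
  r0 : ℤ → Bool
  /-- `X n` is the random character appended at step `n`, for `n ≥ 1` -/
  X : ℕ → Ω → Bool
  hXmeas : ∀ n, Measurable (X n)
  /-- the full configuration (it does not change in time: at time `n` only the
  coordinates `≤ n` are relevant) -/
  cfg : Ω → ℤ → Bool
  hcfg : ∀ ω i, cfg ω i = if i ≤ 0 then r0 i else X i.toNat ω
  /-- `mpos ω n` is the position of the rightmost `1` among the coordinates `≤ n` -/
  mpos : Ω → ℕ → ℤ
  hmpos : ∀ ω n, mpos ω n ≤ (n : ℤ) ∧ cfg ω (mpos ω n) = true ∧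
    ∀ i : ℤ, mpos ω n < i → i ≤ (n : ℤ) → cfg ω i = false
  /-- the transition rule: on any cylinder (in the appended characters) on which the
  distance from `n` to the nearest `1` equals `k` and the word of the `v - 1` letters
  standing to the left of that `1` equals `w`, the conditional probability that the
  character appended at step `n + 1` equals `1` is `p k w`. -/
  htrans : ∀ (n : ℕ) (b : Fin n → Bool) (k : ℕ) (w : Fin (v - 1) → Bool),
    (∀ ω, (∀ i : Fin n, X (i.1 + 1) ω = b i) →
      ((n : ℤ) - mpos ω n = (k : ℤ) ∧
        ∀ j : Fin (v - 1), cfg ω (mpos ω n - ((v : ℤ) - 1) + (j.1 : ℤ)) = w j)) →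
    P {ω | (∀ i : Fin n, X (i.1 + 1) ω = b i) ∧ X (n + 1) ω = true}
      = ENNReal.ofReal (p k w) * P {ω | ∀ i : Fin n, X (i.1 + 1) ω = b i}

open MeasureTheory Filter

namespace VLMC

variable {v : ℕ} {p : ℕ → (Fin (v - 1) → Bool) → ℝ}

/-- Condition [A]: the initial configuration contains at least one `1`, and all the
transition probabilities lie between `δ2` and `δ1`, where `0 < δ2 < δ1 < 1`. -/
def CondA (S : VLMC v p) (δ1 δ2 : ℝ) : Prop :=
  (∃ i : ℤ, i ≤ 0 ∧ S.r0 i = true) ∧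
  0 < δ2 ∧ δ2 < δ1 ∧ δ1 < 1 ∧
  ∀ (k : ℕ) (w : Fin (v - 1) → Bool), δ2 ≤ p k w ∧ p k w ≤ δ1

/-- `R n`, the number of `1`s appended during the first `n` steps -/
def R (S : VLMC v p) (n : ℕ) (ω : S.Ω) : ℕ :=
  ∑ k ∈ Finset.Icc 1 n, (S.X k ω).toNat

/-- `Y(n) = y₀ = (0,(0,…,0,1))`, i.e. the character at position `n` is `1` and the
`v - 1` letters to its left are all `0` -/
def hitY0 (S : VLMC v p) (ω : S.Ω) (n : ℕ) : Prop :=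
  S.mpos ω n = (n : ℤ) ∧
    ∀ j : Fin (v - 1), S.cfg ω ((n : ℤ) - ((v : ℤ) - 1) + (j.1 : ℤ)) = false

/-- `T k`, the time of the `k`-th visit of the chain `Y` to the state `y₀`
(`T 0 = 0`) -/
def T (S : VLMC v p) : ℕ → S.Ω → ℕ
  | 0, _ => 0
  | k + 1, ω => sInf {n | T S k ω < n ∧ S.hitY0 ω n}

/-- `τ_k = T_k - T_{k-1}`, the spacings between consecutive visits to `y₀` -/
def tau (S : VLMC v p) (k : ℕ) (ω : S.Ω) : ℕ := S.T k ω - S.T (k - 1) ω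

/-- `ζ_k`, the number of `1`s appended at the times `n ∈ (T_{k-1}, T_k]` -/
def zeta (S : VLMC v p) (k : ℕ) (ω : S.Ω) : ℕ :=
  ∑ n ∈ Finset.Ioc (S.T (k - 1) ω) (S.T k ω), (S.X n ω).toNat

/-- `ν(n) = max {k ≥ 0 : T_k < n}` -/
def nu (S : VLMC v p) (n : ℕ) (ω : S.Ω) : ℕ := sSup {k | S.T k ω < n}

/-- the generalized renewal process `Z(n) = Σ_{k=0}^{ν(n)} ζ_k` (with `ζ_0 = 0`) -/
def Z (S : VLMC v p) (n : ℕ) (ω : S.Ω) : ℕ :=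
  ∑ k ∈ Finset.range (S.nu n ω + 1), S.zeta k ω

/-- `a = E ζ / E τ`, where `(τ, ζ) = (τ_2, ζ_2)` has the common distribution of the
regeneration vectors `ξ_k = (τ_k, ζ_k)`, `k ≥ 2` -/
def a (S : VLMC v p) : ℝ :=
  (∫ ω, (S.zeta 2 ω : ℝ) ∂S.P) / (∫ ω, (S.tau 2 ω : ℝ) ∂S.P)

/-- `σ² = E (ζ - aτ)² / E τ` -/
def sigma2 (S : VLMC v p) : ℝ :=
  (∫ ω, ((S.zeta 2 ω : ℝ) - S.a * (S.tau 2 ω : ℝ)) ^ 2 ∂S.P) /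
    (∫ ω, (S.tau 2 ω : ℝ) ∂S.P)

/-- `ψ(λ,μ) = E e^{λτ + μζ}` (as an extended nonnegative real number) -/
def psi (S : VLMC v p) (l m : ℝ) : ENNReal :=
  ∫⁻ ω, ENNReal.ofReal (Real.exp (l * S.tau 2 ω + m * S.zeta 2 ω)) ∂S.P

/-- `ψ₁(λ,μ) = E e^{λτ₁ + μζ₁}` -/
def psi1 (S : VLMC v p) (l m : ℝ) : ℝ :=
  ∫ ω, Real.exp (l * S.tau 1 ω + m * S.zeta 1 ω) ∂S.P

/-- the deviation function `D(θ,α) = sup {λθ + μα : A(λ,μ) ≤ 0}` where `A = ln ψ`,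
so that `A(λ,μ) ≤ 0 ↔ ψ(λ,μ) ≤ 1` -/
def D2 (S : VLMC v p) (θ α : ℝ) : ℝ :=
  sSup {x | ∃ l m : ℝ, S.psi l m ≤ 1 ∧ x = l * θ + m * α}

/-- `D(α) = D(1,α)` -/
def D (S : VLMC v p) (α : ℝ) : ℝ := S.D2 1 α

/-- the chain starts from the state `y₀ = (0,(0,…,0,1))`, i.e. `Y(0) = y₀`: the
initial configuration has a `1` at position `0` preceded by `v - 1` zeros -/
def StartsAtY0 (S : VLMC v p) : Prop :=
  S.r0 0 = true ∧ ∀ i : ℤ, 1 - (v : ℤ) ≤ i → i < 0 → S.r0 i = false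

end VLMC

namespace VLMC

/-- The sequence `s n` of real random variables satisfies the large deviation
principle in `ℝ` with normalizing function `φ` (tending to infinity) and rate
function `I : ℝ → [0,∞]`: the sublevel sets `{I ≤ c}` are compact, and for every
Borel set `B` the upper bound along the closure of `B` and the lower bound along
the interior of `B` hold (Definition 1.1; here `ln 0 = -∞`, via `ENNReal.log`). -/
def SatisfiesLDP {Ω : Type*} {mΩ : MeasurableSpace Ω} (P : MeasureTheory.Measure Ω)
    (s : ℕ → Ω → ℝ) (φ : ℕ → ℝ) (I : ℝ → EReal) : Prop :=
  Filter.Tendsto φ Filter.atTop Filter.atTop ∧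
  (∀ c : ℝ, 0 ≤ c → IsCompact {y : ℝ | I y ≤ (c : EReal)}) ∧
  ∀ B : Set ℝ, MeasurableSet B →
    Filter.limsup
        (fun n => (((φ n)⁻¹ : ℝ) : EReal) * ENNReal.log (P {ω | s n ω ∈ B}))
        Filter.atTop ≤ -(⨅ y ∈ closure B, I y) ∧
    -(⨅ y ∈ interior B, I y) ≤
      Filter.liminf
        (fun n => (((φ n)⁻¹ : ℝ) : EReal) * ENNReal.log (P {ω | s n ω ∈ B}))
        Filter.atTop

/-- Exponential upper bound for the scaled logarithm of a probability. -/
lemma inv_mul_log_le {Ω : Type*} {mΩ : MeasurableSpace Ω} {P : Measure Ω} [IsFiniteMeasure P]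
    {A : Set Ω} {c x : ℝ} (hc : 0 < c) (h : P.real A ≤ Real.exp (c * x)) :
    ((c⁻¹ : ℝ) : EReal) * ENNReal.log (P A) ≤ (x : EReal) := by
  have h1 : P A ≤ ENNReal.ofReal (Real.exp (c * x)) := by
    rw [← ofReal_measureReal (measure_ne_top P A)]
    exact ENNReal.ofReal_le_ofReal h
  have h2 := ENNReal.log_le_log h1
  rw [ENNReal.log_ofReal_of_pos (Real.exp_pos _), Real.log_exp] at h2
  calc ((c⁻¹ : ℝ) : EReal) * ENNReal.log (P A)
      ≤ ((c⁻¹ : ℝ) : EReal) * ((c * x : ℝ) : EReal) :=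
        mul_le_mul_of_nonneg_left h2 (by exact_mod_cast (inv_pos.2 hc).le)
    _ = (x : EReal) := by
        rw [← EReal.coe_mul]; congr 1; field_simp

/-- Exponential lower bound for the scaled logarithm of a probability. -/
lemma le_inv_mul_log {Ω : Type*} {mΩ : MeasurableSpace Ω} {P : Measure Ω} [IsFiniteMeasure P]
    {A : Set Ω} {c x : ℝ} (hc : 0 < c) (h : Real.exp (c * x) ≤ P.real A) :
    (x : EReal) ≤ ((c⁻¹ : ℝ) : EReal) * ENNReal.log (P A) := by
  have h1 : ENNReal.ofReal (Real.exp (c * x)) ≤ P A := by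
    rw [← ofReal_measureReal (measure_ne_top P A)]
    exact ENNReal.ofReal_le_ofReal h
  have h2 := ENNReal.log_le_log h1
  rw [ENNReal.log_ofReal_of_pos (Real.exp_pos _), Real.log_exp] at h2
  calc (x : EReal) = ((c⁻¹ : ℝ) : EReal) * ((c * x : ℝ) : EReal) := by
        rw [← EReal.coe_mul]; congr 1; field_simp
    _ ≤ ((c⁻¹ : ℝ) : EReal) * ENNReal.log (P A) :=
        mul_le_mul_of_nonneg_left h2 (by exact_mod_cast (inv_pos.2 hc).le)

section GaussianLDP

open ProbabilityTheory Topology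

variable {Ω : Type*} {mΩ : MeasurableSpace Ω} {P : Measure Ω} [IsProbabilityMeasure P]
  {s : ℕ → Ω → ℝ} {φ : ℕ → ℝ} {σ2 : ℝ}

/-- Two-sided Chernoff bound under a Gaussian limit of the scaled cumulant generating
functions. -/
lemma eventually_measureReal_abs_ge_le (hσ : 0 < σ2) (hφ : Tendsto φ atTop atTop)
    (h_int : ∀ n t, Integrable (fun ω => Real.exp (t * s n ω)) P)
    (hΛ : ∀ t : ℝ, Tendsto (fun n => (φ n)⁻¹ * cgf (s n) P (t * φ n)) atTop
      (𝓝 (t ^ 2 * σ2 / 2)))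
    {d η : ℝ} (hd : 0 ≤ d) (hη : 0 < η) :
    ∀ᶠ n in atTop, P.real {ω | d ≤ |s n ω|} ≤
      Real.exp (φ n * (-(d ^ 2 / (2 * σ2)) + η)) := by
  have h1 := (hΛ (d / σ2)).eventually_lt_const
    (show (d / σ2) ^ 2 * σ2 / 2 < (d / σ2) ^ 2 * σ2 / 2 + η / 2 by linarith)
  have h2 := (hΛ (-(d / σ2))).eventually_lt_const
    (show (-(d / σ2)) ^ 2 * σ2 / 2 < (d / σ2) ^ 2 * σ2 / 2 + η / 2 by
      rw [neg_sq]; linarith)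
  have hlog : ∀ᶠ n in atTop, Real.log 2 * 2 / η ≤ φ n := hφ.eventually_ge_atTop _
  filter_upwards [h1, h2, hlog, hφ.eventually_gt_atTop 0] with n h1 h2 h3 h4
  have key : (d / σ2) ^ 2 * σ2 / 2 = d / σ2 * d - d ^ 2 / (2 * σ2) := by
    field_simp; ring
  rw [key] at h1 h2
  have e1 : cgf (s n) P (d / σ2 * φ n) ≤
      φ n * (d / σ2 * d - d ^ 2 / (2 * σ2) + η / 2) := by
    rw [inv_mul_lt_iff₀ h4] at h1; exact h1.le
  have e2 : cgf (s n) P (-(d / σ2) * φ n) ≤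
      φ n * (d / σ2 * d - d ^ 2 / (2 * σ2) + η / 2) := by
    rw [inv_mul_lt_iff₀ h4] at h2; exact h2.le
  have hdσ : 0 ≤ d / σ2 := by positivity
  have c1 : P.real {ω | d ≤ s n ω} ≤ _ :=
    measure_ge_le_exp_cgf (μ := P) d (mul_nonneg hdσ h4.le) (h_int n (d / σ2 * φ n))
  have c2 : P.real {ω | s n ω ≤ -d} ≤ _ :=
    measure_le_le_exp_cgf (μ := P) (-d) (t := -(d / σ2) * φ n)
      (by rw [neg_mul]; exact neg_nonpos.2 (mul_nonneg hdσ h4.le)) (h_int n (-(d / σ2) * φ n))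
  have hsub : {ω | d ≤ |s n ω|} ⊆ {ω | d ≤ s n ω} ∪ {ω | s n ω ≤ -d} := by
    intro ω hω
    rcases le_abs.1 (show d ≤ |s n ω| from hω) with h | h
    · exact Or.inl h
    · exact Or.inr (by show s n ω ≤ -d; linarith)
  have d1 : P.real {ω | d ≤ s n ω} ≤ Real.exp (φ n * (-(d ^ 2 / (2 * σ2)) + η / 2)) :=
    c1.trans (Real.exp_le_exp.2 (by linarith))
  have d2 : P.real {ω | s n ω ≤ -d} ≤ Real.exp (φ n * (-(d ^ 2 / (2 * σ2)) + η / 2)) :=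
    c2.trans (Real.exp_le_exp.2 (by linarith))
  calc P.real {ω | d ≤ |s n ω|} ≤ _ := measureReal_mono hsub
    _ ≤ P.real {ω | d ≤ s n ω} + P.real {ω | s n ω ≤ -d} := measureReal_union_le _ _
    _ ≤ 2 * Real.exp (φ n * (-(d ^ 2 / (2 * σ2)) + η / 2)) := by linarith
    _ = Real.exp (Real.log 2 + φ n * (-(d ^ 2 / (2 * σ2)) + η / 2)) := by
        rw [Real.exp_add, Real.exp_log two_pos]
    _ ≤ Real.exp (φ n * (-(d ^ 2 / (2 * σ2)) + η)) := by
        rw [div_le_iff₀ hη] at h3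
        exact Real.exp_le_exp.2 (by linarith)

/-- Exponential tilting: the moment generating function at `t` is controlled by the
probability of a ball around `y` and by the moment generating functions at `t ± u`. -/
lemma mgf_le_measureReal_ball_add {X : Ω → ℝ} (hX : Measurable X)
    (h_int : ∀ t, Integrable (fun ω => Real.exp (t * X ω)) P)
    (t y : ℝ) {c u : ℝ} (r : ℝ) (hc : 0 < c) (hu : 0 < u) :
    mgf X P (t * c) ≤ P.real {ω | |X ω - y| < r} * Real.exp (c * (t * y + |t| * r))
      + Real.exp (-(c * (u * (y + r)))) * mgf X P ((t + u) * c)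
      + Real.exp (c * (u * (y - r))) * mgf X P ((t - u) * c) := by
  set A := {ω | |X ω - y| < r} with hA
  have hAm : MeasurableSet A := measurableSet_lt (hX.sub_const y).abs measurable_const
  have hpt : ∀ ω, Real.exp (t * c * X ω) ≤
      A.indicator (fun _ => Real.exp (c * (t * y + |t| * r))) ω
      + Real.exp (-(c * (u * (y + r)))) * Real.exp ((t + u) * c * X ω)
      + Real.exp (c * (u * (y - r))) * Real.exp ((t - u) * c * X ω) := by
    intro ω
    rw [← Real.exp_add, ← Real.exp_add]
    by_cases hω : ω ∈ A
    · rw [Set.indicator_of_mem hω]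
      have hts : t * (X ω - y) ≤ |t| * r :=
        (le_abs_self _).trans (by
          rw [abs_mul]; exact mul_le_mul_of_nonneg_left (le_of_lt hω) (abs_nonneg t))
      have : Real.exp (t * c * X ω) ≤ Real.exp (c * (t * y + |t| * r)) := by
        refine Real.exp_le_exp.2 ?_
        nlinarith
      have := Real.exp_pos (-(c * (u * (y + r))) + (t + u) * c * X ω)
      have := Real.exp_pos (c * (u * (y - r)) + (t - u) * c * X ω)
      linarith
    · rw [Set.indicator_of_notMem hω, zero_add]
      have hω' : r ≤ |X ω - y| := not_lt.1 hω
      have p1 := Real.exp_pos (-(c * (u * (y + r))) + (t + u) * c * X ω)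
      have p2 := Real.exp_pos (c * (u * (y - r)) + (t - u) * c * X ω)
      have hφu : 0 < c * u := mul_pos hc hu
      rcases le_abs.1 hω' with h | h
      · have : Real.exp (t * c * X ω) ≤
            Real.exp (-(c * (u * (y + r))) + (t + u) * c * X ω) :=
          Real.exp_le_exp.2 (by nlinarith)
        linarith
      · have : Real.exp (t * c * X ω) ≤
            Real.exp (c * (u * (y - r)) + (t - u) * c * X ω) :=
          Real.exp_le_exp.2 (by nlinarith)
        linarith
  have hi0 : Integrable (A.indicator (fun _ => Real.exp (c * (t * y + |t| * r)))) P :=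
    (integrable_const _).indicator hAm
  have hi1 := (h_int ((t + u) * c)).const_mul (Real.exp (-(c * (u * (y + r)))))
  have hi2 := (h_int ((t - u) * c)).const_mul (Real.exp (c * (u * (y - r))))
  have hle := integral_mono (h_int (t * c)) ((hi0.add hi1).add hi2) hpt
  have hsum : ∫ ω, (A.indicator (fun _ => Real.exp (c * (t * y + |t| * r))) ω
      + Real.exp (-(c * (u * (y + r)))) * Real.exp ((t + u) * c * X ω)
      + Real.exp (c * (u * (y - r))) * Real.exp ((t - u) * c * X ω)) ∂P
      = P.real A * Real.exp (c * (t * y + |t| * r))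
        + Real.exp (-(c * (u * (y + r)))) * mgf X P ((t + u) * c)
        + Real.exp (c * (u * (y - r))) * mgf X P ((t - u) * c) := by
    rw [integral_add (f := fun ω => A.indicator (fun _ => Real.exp (c * (t * y + |t| * r))) ω
      + Real.exp (-(c * (u * (y + r)))) * Real.exp ((t + u) * c * X ω)) (hi0.add hi1) hi2,
      integral_add hi0 hi1, integral_indicator_const _ hAm,
      integral_const_mul, integral_const_mul]
    rfl
  exact hle.trans_eq hsum

/-- Local lower bound under a Gaussian limit of the scaled cumulant generating functions. -/
lemma eventually_le_measureReal_abs_sub_lt (hσ : 0 < σ2) (hφ : Tendsto φ atTop atTop)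
    (hs : ∀ n, Measurable (s n))
    (h_int : ∀ n t, Integrable (fun ω => Real.exp (t * s n ω)) P)
    (hΛ : ∀ t : ℝ, Tendsto (fun n => (φ n)⁻¹ * cgf (s n) P (t * φ n)) atTop
      (𝓝 (t ^ 2 * σ2 / 2)))
    (y : ℝ) {r η : ℝ} (hr : 0 < r) (hη : 0 < η) :
    ∀ᶠ n in atTop, Real.exp (φ n * (-(y ^ 2 / (2 * σ2)) - |y / σ2| * r - η)) ≤
      P.real {ω | |s n ω - y| < r} := by
  set t := y / σ2 with ht
  set u := r / σ2 with hu
  set e := min (η / 2) (r ^ 2 / (8 * σ2)) with he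
  have hepos : 0 < e := lt_min (by linarith) (by positivity)
  have hy : y = t * σ2 := by rw [ht]; field_simp
  have hru : r = u * σ2 := by rw [hu]; field_simp
  have hupos : 0 < u := by positivity
  have he1 : e ≤ η / 2 := min_le_left _ _
  have he2 : e ≤ u ^ 2 * σ2 / 8 := by
    refine (min_le_right _ _).trans_eq ?_
    rw [hru]; field_simp
  have hy2 : y ^ 2 / (2 * σ2) = t ^ 2 * σ2 / 2 := by rw [hy]; field_simp
  have h1 := (hΛ t).eventually_const_lt (show t ^ 2 * σ2 / 2 - e < _ by linarith)
  have h2 := (hΛ (t + u)).eventually_lt_const (show _ < (t + u) ^ 2 * σ2 / 2 + e by linarith)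
  have h3 := (hΛ (t - u)).eventually_lt_const (show _ < (t - u) ^ 2 * σ2 / 2 + e by linarith)
  have h4 : ∀ᶠ n in atTop, Real.log 4 / e ≤ φ n := hφ.eventually_ge_atTop _
  filter_upwards [h1, h2, h3, h4, hφ.eventually_gt_atTop 0] with n h1 h2 h3 h4 h5
  rw [lt_inv_mul_iff₀ h5] at h1
  rw [inv_mul_lt_iff₀ h5] at h2 h3
  rw [div_le_iff₀ hepos] at h4
  have hle' := mgf_le_measureReal_ball_add (hs n) (h_int n) t y r h5 hupos
  rw [← exp_cgf (h_int n (t * φ n)), ← exp_cgf (h_int n ((t + u) * φ n)),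
    ← exp_cgf (h_int n ((t - u) * φ n)), ← Real.exp_add, ← Real.exp_add] at hle'
  have hE : Real.exp (φ n * (t ^ 2 * σ2 / 2 - e)) ≤ Real.exp (cgf (s n) P (t * φ n)) :=
    Real.exp_le_exp.2 h1.le
  have hX : 4 * Real.exp (φ n * (t ^ 2 * σ2 / 2 - 2 * e)) ≤
      Real.exp (φ n * (t ^ 2 * σ2 / 2 - e)) := by
    rw [show (4 : ℝ) = Real.exp (Real.log 4) from (Real.exp_log (by norm_num)).symm,
      ← Real.exp_add]
    exact Real.exp_le_exp.2 (by linarith)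
  have hX1 : Real.exp (-(φ n * (u * (y + r))) + cgf (s n) P ((t + u) * φ n)) ≤
      Real.exp (φ n * (t ^ 2 * σ2 / 2 - 2 * e)) := by
    refine Real.exp_le_exp.2 ?_
    have : (t + u) ^ 2 * σ2 / 2 + e - u * (y + r) ≤ t ^ 2 * σ2 / 2 - 2 * e := by
      have : (t + u) ^ 2 * σ2 / 2 + e - u * (y + r) = t ^ 2 * σ2 / 2 - u ^ 2 * σ2 / 2 + e := by
        rw [hy, hru]; ring
      linarith
    linarith [mul_le_mul_of_nonneg_left this h5.le]
  have hX2 : Real.exp (φ n * (u * (y - r)) + cgf (s n) P ((t - u) * φ n)) ≤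
      Real.exp (φ n * (t ^ 2 * σ2 / 2 - 2 * e)) := by
    refine Real.exp_le_exp.2 ?_
    have : (t - u) ^ 2 * σ2 / 2 + e + u * (y - r) ≤ t ^ 2 * σ2 / 2 - 2 * e := by
      have : (t - u) ^ 2 * σ2 / 2 + e + u * (y - r) = t ^ 2 * σ2 / 2 - u ^ 2 * σ2 / 2 + e := by
        rw [hy, hru]; ring
      linarith
    linarith [mul_le_mul_of_nonneg_left this h5.le]
  have hpos := Real.exp_pos (φ n * (t ^ 2 * σ2 / 2 - 2 * e))
  have hfin : Real.exp (φ n * (t ^ 2 * σ2 / 2 - 2 * e)) ≤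
      P.real {ω | |s n ω - y| < r} * Real.exp (φ n * (t * y + |t| * r)) := by linarith
  have hdiv : Real.exp (φ n * (t ^ 2 * σ2 / 2 - 2 * e) - φ n * (t * y + |t| * r)) ≤
      P.real {ω | |s n ω - y| < r} := by
    rw [Real.exp_sub, div_le_iff₀ (Real.exp_pos _)]; exact hfin
  refine le_trans (Real.exp_le_exp.2 ?_) hdiv
  rw [← mul_sub]
  refine mul_le_mul_of_nonneg_left ?_ h5.le
  have : t * y = t ^ 2 * σ2 := by rw [hy]; ring
  linarith

/-- One-dimensional Gärtner–Ellis theorem with a Gaussian limit: if the scaled cumulant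
generating functions converge to `t ↦ t² σ² / 2`, then the large deviation principle holds
with rate function `y² / (2σ²)`. -/
theorem satisfiesLDP_of_tendsto_cgf (hσ : 0 < σ2) (hφ : Tendsto φ atTop atTop)
    (hs : ∀ n, Measurable (s n))
    (h_int : ∀ n t, Integrable (fun ω => Real.exp (t * s n ω)) P)
    (hΛ : ∀ t : ℝ, Tendsto (fun n => (φ n)⁻¹ * cgf (s n) P (t * φ n)) atTop
      (𝓝 (t ^ 2 * σ2 / 2))) :
    SatisfiesLDP P s φ (fun y => ((y ^ 2 / (2 * σ2) : ℝ) : EReal)) := by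
  refine ⟨hφ, fun c hc => ?_, fun B _ => ⟨?_, ?_⟩⟩
  · have hset : {y : ℝ | ((y ^ 2 / (2 * σ2) : ℝ) : EReal) ≤ (c : EReal)} =
        Set.Icc (-√(c * (2 * σ2))) (√(c * (2 * σ2))) := by
      ext y
      rw [Set.mem_ofPred_eq, EReal.coe_le_coe_iff, div_le_iff₀ (by positivity), Set.mem_Icc,
        ← abs_le, ← Real.sqrt_sq_eq_abs, Real.sqrt_le_sqrt_iff (by positivity)]
    rw [hset]
    exact isCompact_Icc
  · rcases B.eq_empty_or_nonempty with rfl | hB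
    · have : (fun n => (((φ n)⁻¹ : ℝ) : EReal) * ENNReal.log (P {ω | s n ω ∈ (∅ : Set ℝ)}))
          =ᶠ[atTop] fun _ => (⊥ : EReal) := by
        filter_upwards [hφ.eventually_gt_atTop 0] with n hn
        simpa using EReal.coe_mul_bot_of_pos (inv_pos.2 hn)
      rw [limsup_congr this]
      simp
    · obtain ⟨z, hz, hdz⟩ := isClosed_closure.exists_infDist_eq_dist hB.closure (0 : ℝ)
      rw [dist_zero_left, Real.norm_eq_abs] at hdz
      have hmin : ∀ x ∈ B, |z| ≤ |x| := fun x hx => by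
        have := Metric.infDist_le_dist_of_mem (x := (0 : ℝ)) (subset_closure hx)
        rwa [hdz, dist_zero_left, Real.norm_eq_abs] at this
      have hlim : limsup (fun n => (((φ n)⁻¹ : ℝ) : EReal) * ENNReal.log (P {ω | s n ω ∈ B}))
          atTop ≤ ((-(z ^ 2 / (2 * σ2)) : ℝ) : EReal) := by
        refine EReal.le_of_forall_lt_iff_le.1 fun x hx => ?_
        rw [EReal.coe_lt_coe_iff] at hx
        refine limsup_le_of_le (by isBoundedDefault) ?_
        filter_upwards [eventually_measureReal_abs_ge_le hσ hφ h_int hΛ (abs_nonneg z)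
          (sub_pos.2 hx), hφ.eventually_gt_atTop 0] with n hn hpos
        refine inv_mul_log_le hpos ((measureReal_mono (s₂ := {ω | |z| ≤ |s n ω|})
          fun ω hω => hmin _ hω).trans (hn.trans_eq ?_))
        rw [sq_abs]; ring_nf
      refine hlim.trans ?_
      rw [EReal.coe_neg]
      exact EReal.neg_le_neg_iff.2 (iInf₂_le z hz)
  · rw [EReal.neg_le]
    refine le_iInf₂ fun y hy => ?_
    rw [EReal.neg_le, ← EReal.coe_neg]
    refine EReal.ge_of_forall_gt_iff_ge.1 fun x hx => ?_
    rw [EReal.coe_lt_coe_iff] at hx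
    obtain ⟨ε, hε, hball⟩ := Metric.isOpen_iff.1 isOpen_interior y hy
    set g := -(y ^ 2 / (2 * σ2)) - x with hg
    have hgpos : 0 < g := sub_pos.2 hx
    set r := min ε (g / (2 * (|y / σ2| + 1))) with hr
    have hrpos : 0 < r := lt_min hε (by positivity)
    have hrg : |y / σ2| * r ≤ g / 2 := by
      have h1 : r ≤ g / (2 * (|y / σ2| + 1)) := min_le_right _ _
      rw [le_div_iff₀ (by positivity)] at h1
      nlinarith [abs_nonneg (y / σ2)]
    refine le_liminf_of_le (by isBoundedDefault) ?_
    filter_upwards [eventually_le_measureReal_abs_sub_lt hσ hφ hs h_int hΛ y hrpos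
      (half_pos hgpos), hφ.eventually_gt_atTop 0] with n hn hpos
    have hsub : {ω | |s n ω - y| < r} ⊆ {ω | s n ω ∈ B} := fun ω hω => by
      show s n ω ∈ B
      refine interior_subset (hball ?_)
      rw [Metric.mem_ball, Real.dist_eq]
      exact lt_of_lt_of_le hω (min_le_left _ _)
    exact le_inv_mul_log hpos ((Real.exp_le_exp.2 (mul_le_mul_of_nonneg_left (by linarith)
      hpos.le)).trans (hn.trans (measureReal_mono hsub)))

end GaussianLDP

section Averaging

variable {α : Type*}

/-- The mean of `F y b` when the letter `b` is `true` with probability `q y`. -/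
def avg (q : α → ℝ) (F : α → Bool → ℝ) (y : α) : ℝ :=
  q y * F y true + (1 - q y) * F y false

variable {q : α → ℝ} {F G : α → Bool → ℝ} {y : α}

lemma avg_mono (hq : 0 ≤ q y ∧ q y ≤ 1) (h : ∀ b, F y b ≤ G y b) : avg q F y ≤ avg q G y :=
  add_le_add (mul_le_mul_of_nonneg_left (h true) hq.1)
    (mul_le_mul_of_nonneg_left (h false) (sub_nonneg.2 hq.2))

lemma avg_const (q : α → ℝ) (c : ℝ) (y : α) : avg q (fun _ _ => c) y = c := by
  simp only [avg]; ring

lemma abs_avg_le_avg (hq : 0 ≤ q y ∧ q y ≤ 1) (h : ∀ b, |F y b| ≤ G y b) :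
    |avg q F y| ≤ avg q G y := by
  rw [abs_le]
  constructor
  · have : avg q (fun y b => -G y b) y ≤ avg q F y :=
      avg_mono hq fun b => (abs_le.1 (h b)).1
    simp only [avg] at this ⊢
    linarith
  · exact avg_mono hq fun b => (abs_le.1 (h b)).2

lemma abs_avg_le (hq : 0 ≤ q y ∧ q y ≤ 1) {c : ℝ} (h : ∀ b, |F y b| ≤ c) : |avg q F y| ≤ c :=
  (abs_avg_le_avg (G := fun _ _ => c) hq h).trans_eq (avg_const q c y)

open Classical in
/-- The transition operator of the chain with transitions `y ↦ step y b`, killed upon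
entering `y₀`. -/
def killed (q : α → ℝ) (step : α → Bool → α) (y₀ : α) (f : α → ℝ) : α → ℝ :=
  avg q fun y b => if step y b = y₀ then 0 else f (step y b)

variable {step : α → Bool → α} {y₀ : α}

open Classical in
lemma killed_eq_avg {f : α → ℝ} (hf : f y₀ = 0) (y : α) :
    killed q step y₀ f y = avg q (fun y b => f (step y b)) y := by
  have hb : ∀ b, (if step y b = y₀ then 0 else f (step y b)) = f (step y b) := fun b => by
    split_ifs with h
    · rw [h, hf]
    · rfl
  simp only [killed, avg, hb]

/-- Under a drift condition, the killed transition operator has a bounded potential. -/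
lemma exists_killed_potential (hq : ∀ y, 0 ≤ q y ∧ q y ≤ 1) {h : α → ℝ} {H : ℝ}
    (h1 : ∀ y, 1 ≤ h y) (hH : ∀ y, h y ≤ H) (hL : ∀ y, 1 + killed q step y₀ h y ≤ h y)
    {f : α → ℝ} {c : ℝ} (hf : ∀ y, |f y| ≤ c) :
    ∃ (u : α → ℝ) (C : ℝ), (∀ y, |u y| ≤ C) ∧ (∀ y, u y = f y + killed q step y₀ u y) ∧
      ((∀ y, 0 ≤ f y) → ∀ y, f y ≤ u y) := by
  classical
  rcases isEmpty_or_nonempty α with hα | ⟨⟨z⟩⟩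
  · exact ⟨f, 0, fun y => isEmptyElim y, fun y => isEmptyElim y, fun _ y => isEmptyElim y⟩
  have hH1 : 1 ≤ H := (h1 z).trans (hH z)
  have hHpos : 0 < H := one_pos.trans_le hH1
  have hc : 0 ≤ c := (abs_nonneg _).trans (hf z)
  set ρ := 1 - 1 / H with hρ
  have hρ0 : 0 ≤ ρ := sub_nonneg.2 ((div_le_one hHpos).2 hH1)
  have hρ1 : ρ < 1 := by rw [hρ]; linarith [one_div_pos.2 hHpos]
  set k : ℕ → α → ℝ := fun n => (killed q step y₀)^[n] f with hk
  have hk_succ : ∀ n, k (n + 1) = killed q step y₀ (k n) := fun n =>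
    Function.iterate_succ_apply' _ _ _
  have hbound : ∀ n y, |k n y| ≤ c * ρ ^ n * h y := by
    intro n
    induction n with
    | zero =>
      intro y
      refine (hf y).trans ?_
      simpa using mul_le_mul_of_nonneg_left (h1 y) hc
    | succ n ih =>
      intro y
      have hA : 0 ≤ c * ρ ^ n := by positivity
      rw [hk_succ]
      have s1 : |killed q step y₀ (k n) y| ≤
          avg q (fun y b => if step y b = y₀ then 0 else c * ρ ^ n * h (step y b)) y := by
        refine abs_avg_le_avg (hq y) fun b => ?_
        split_ifs
        · simp
        · exact ih _
      have s2 : avg q (fun y b => if step y b = y₀ then 0 else c * ρ ^ n * h (step y b)) y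
          = c * ρ ^ n * killed q step y₀ h y := by
        simp only [killed, avg]
        split_ifs <;> ring
      have s3 : killed q step y₀ h y ≤ ρ * h y := by
        have e1 : h y / H ≤ 1 := (div_le_one hHpos).2 (hH y)
        have e2 : ρ * h y = h y - h y / H := by rw [hρ]; ring
        linarith [hL y]
      calc |killed q step y₀ (k n) y| ≤ c * ρ ^ n * killed q step y₀ h y := s1.trans_eq s2
        _ ≤ c * ρ ^ n * (ρ * h y) := mul_le_mul_of_nonneg_left s3 hA
        _ = c * ρ ^ (n + 1) * h y := by ring
  have hbound' : ∀ y n, ‖k n y‖ ≤ c * H * ρ ^ n := fun y n => by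
    have hA : 0 ≤ c * ρ ^ n := by positivity
    calc ‖k n y‖ ≤ c * ρ ^ n * h y := hbound n y
      _ ≤ c * ρ ^ n * H := mul_le_mul_of_nonneg_left (hH y) hA
      _ = c * H * ρ ^ n := by ring
  have hgeo : Summable fun n => c * H * ρ ^ n :=
    (summable_geometric_of_lt_one hρ0 hρ1).mul_left _
  have hsum : ∀ y, Summable fun n => k n y := fun y =>
    Summable.of_norm_bounded hgeo (hbound' y)
  have hkilled : ∀ y, HasSum (fun n => killed q step y₀ (k n) y)
      (killed q step y₀ (fun y => ∑' n, k n y) y) := by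
    intro y
    have hb : ∀ b, HasSum (fun n => if step y b = y₀ then 0 else k n (step y b))
        (if step y b = y₀ then 0 else ∑' n, k n (step y b)) := fun b => by
      split_ifs
      · exact hasSum_zero
      · exact (hsum _).hasSum
    exact ((hb true).mul_left (q y)).add ((hb false).mul_left (1 - q y))
  refine ⟨fun y => ∑' n, k n y, ∑' n, c * H * ρ ^ n, fun y => ?_, fun y => ?_, fun hf0 y => ?_⟩
  · exact tsum_of_norm_bounded hgeo.hasSum (hbound' y)
  · beta_reduce
    rw [(hsum y).tsum_eq_zero_add, ← (hkilled y).tsum_eq]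
    simp only [hk_succ]
    rfl
  · have hk0 : ∀ n y, 0 ≤ k n y := by
      intro n
      induction n with
      | zero => exact hf0
      | succ n ih =>
        intro y
        rw [hk_succ, ← avg_const q 0 y]
        refine avg_mono (hq y) fun b => ?_
        split_ifs
        · exact le_rfl
        · exact ih _
    exact (hsum y).le_tsum 0 fun n _ => hk0 n y

/-- Bounded solutions of the Poisson equation, normalized to vanish at `y₀`. -/
lemma exists_poisson_solution (hq : ∀ y, 0 ≤ q y ∧ q y ≤ 1) {h : α → ℝ} {H : ℝ}
    (h1 : ∀ y, 1 ≤ h y) (hH : ∀ y, h y ≤ H) (hL : ∀ y, 1 + killed q step y₀ h y ≤ h y)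
    {f : α → ℝ} {c : ℝ} (hf : ∀ y, |f y| ≤ c) :
    ∃ (m : ℝ) (g : α → ℝ) (C : ℝ), (∀ y, |g y| ≤ C) ∧ g y₀ = 0 ∧
      (∀ y, g y = f y - m + avg q (fun y b => g (step y b)) y) ∧
      ((∀ y, 0 ≤ f y) → 0 ≤ m ∧ (m = 0 → ∀ y, 0 ≤ g y)) := by
  obtain ⟨u, C, huC, hu, hu0⟩ := exists_killed_potential hq h1 hH hL hf
  obtain ⟨w, C', hwC, hw, hw0⟩ := exists_killed_potential (f := fun _ => 1) (c := 1) hq h1 hH hL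
    (fun _ => by simp)
  have hw1 : 1 ≤ w y₀ := hw0 (fun _ => zero_le_one) y₀
  have hg0 : u y₀ - u y₀ / w y₀ * w y₀ = 0 := by
    rw [div_mul_cancel₀ _ (by linarith), sub_self]
  refine ⟨u y₀ / w y₀, fun y => u y - u y₀ / w y₀ * w y, C + |u y₀ / w y₀| * C', fun y => ?_,
    hg0, fun y => ?_, fun hf0 => ⟨?_, fun hm y => ?_⟩⟩
  · refine (abs_sub _ _).trans (add_le_add (huC y) ?_)
    rw [abs_mul]
    exact mul_le_mul_of_nonneg_left (hwC y) (abs_nonneg _)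
  · rw [← killed_eq_avg (f := fun y => u y - u y₀ / w y₀ * w y) hg0 y]
    have hlin : killed q step y₀ (fun y => u y - u y₀ / w y₀ * w y) y =
        killed q step y₀ u y - u y₀ / w y₀ * killed q step y₀ w y := by
      simp only [killed, avg]
      split_ifs <;> ring
    rw [hlin]
    linear_combination hu y - u y₀ / w y₀ * hw y
  · exact div_nonneg ((hf0 y₀).trans (hu0 hf0 y₀)) (by linarith)
  · simp only [hm, zero_mul, sub_zero]
    exact (hf0 y).trans (hu0 hf0 y)

end Averaging

section StateSpace

variable {v : ℕ}

/-- The state space of the chain `Y`: the distance to the nearest `1`, and the `v - 1` letters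
to the left of that `1`. -/
abbrev State (v : ℕ) := ℕ × (Fin (v - 1) → Bool)

/-- The state reached from `y` when a letter is appended. -/
def nextState (y : State v) : Bool → State v
  | true => (0, fun j => if h : j.1 + y.1 + 1 < v - 1 then y.2 ⟨j.1 + y.1 + 1, h⟩
      else decide (j.1 + y.1 + 1 = v - 1))
  | false => (y.1 + 1, y.2)

/-- The state `y₀ = (0, (0, …, 0, 1))`. -/
def baseState (v : ℕ) : State v := (0, fun _ => false)

lemma nextState_true_eq_baseState {y : State v} (hy : v - 1 ≤ y.1) :
    nextState y true = baseState v := by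
  refine Prod.ext rfl (funext fun j => ?_)
  have h1 : ¬ j.1 + y.1 + 1 < v - 1 := by omega
  have h2 : ¬ j.1 + y.1 + 1 = v - 1 := by omega
  simp only [nextState, baseState, h1, h2, dif_neg, not_false_eq_true, decide_false]

/-- The chain satisfies a drift condition towards `y₀`. -/
lemma exists_drift_function {q : State v → ℝ} {δ1 δ2 : ℝ} (hδ2 : 0 < δ2) (hδ1 : δ1 < 1)
    (hq : ∀ y, δ2 ≤ q y ∧ q y ≤ δ1) :
    ∃ (h : State v → ℝ) (H : ℝ), (∀ y, 1 ≤ h y) ∧ (∀ y, h y ≤ H) ∧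
      ∀ y, 1 + killed q nextState (baseState v) h y ≤ h y := by
  have hδ : δ2 ≤ δ1 := (hq (baseState v)).1.trans (hq (baseState v)).2
  have h1δ : 0 < 1 - δ1 := sub_pos.2 hδ1
  set d : ℕ → ℝ := fun k => Nat.rec 0 (fun _ x => (1 + x) / (1 - δ1)) k with hd
  have hd0 : d 0 = 0 := rfl
  have hd_succ : ∀ k, (1 - δ1) * d (k + 1) = 1 + d k := fun k => by
    change (1 - δ1) * ((1 + d k) / (1 - δ1)) = 1 + d k
    field_simp
  have hd_nonneg : ∀ k, 0 ≤ d k := by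
    intro k
    induction k with
    | zero => exact hd0.ge
    | succ k ih => exact div_nonneg (add_nonneg zero_le_one ih) h1δ.le
  have hd_mono : Monotone d := monotone_nat_of_le_succ fun k => by
    nlinarith [hd_succ k, hd_nonneg (k + 1)]
  have hδ2inv : 1 ≤ 1 / δ2 := (one_le_div hδ2).2 (by linarith)
  refine ⟨fun y => d (v - 1) + 1 / δ2 - d (min y.1 (v - 1)), d (v - 1) + 1 / δ2, fun y => ?_,
    fun y => ?_, fun y => ?_⟩
  · linarith [hd_mono (min_le_right y.1 (v - 1))]
  · linarith [hd_nonneg (min y.1 (v - 1))]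
  · obtain ⟨hq2, hq1⟩ := hq y
    have hpos : 0 ≤ q y ∧ q y ≤ 1 := ⟨by linarith, by linarith⟩
    rcases le_or_gt (v - 1) y.1 with hy | hy
    · have hfalse : min (nextState y false).1 (v - 1) = v - 1 :=
        min_eq_right (hy.trans (Nat.le_succ _))
      have hne : (nextState y false) ≠ baseState v := fun h => by
        have := congrArg Prod.fst h
        simp [nextState, baseState] at this
      simp only [killed, avg, nextState_true_eq_baseState hy, if_true, hne, if_false, hfalse,
        min_eq_right hy]
      have : δ2 * (1 / δ2) = 1 := by field_simp
      nlinarith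
    · have hle : killed q nextState (baseState v)
          (fun y => d (v - 1) + 1 / δ2 - d (min y.1 (v - 1))) y ≤
          avg q (fun y b => d (v - 1) + 1 / δ2 - d (min (nextState y b).1 (v - 1))) y := by
        refine avg_mono hpos fun b => ?_
        split_ifs
        · linarith [hd_mono (min_le_right (nextState y b).1 (v - 1))]
        · exact le_rfl
      have htrue : min (nextState y true).1 (v - 1) = 0 := by simp [nextState]
      have hfalse : min (nextState y false).1 (v - 1) = y.1 + 1 :=
        min_eq_left hy
      simp only [avg, htrue, hfalse, hd0] at hle
      beta_reduce
      rw [min_eq_left hy.le]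
      nlinarith [hd_succ y.1, hd_nonneg (y.1 + 1)]

/-- The increments of the martingale `R(n) - a n + g(Y(n))`. -/
def incr (a : ℝ) (g : State v → ℝ) (y : State v) (b : Bool) : ℝ :=
  (b.toNat : ℝ) - a + (g (nextState y b) - g y)

/-- The compensated squared increments of the martingale `R(n) - a n + g(Y(n))`. -/
def incrSq (a σ2 : ℝ) (g g2 : State v → ℝ) (y : State v) (b : Bool) : ℝ :=
  incr a g y b ^ 2 / 2 - σ2 / 2 + (g2 (nextState y b) - g2 y)

/-- First and second order correctors, with a nondegenerate variance. -/
lemma exists_correctors {q : State v → ℝ} {δ1 δ2 : ℝ} (hδ2 : 0 < δ2) (hδ1 : δ1 < 1)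
    (hq : ∀ y, δ2 ≤ q y ∧ q y ≤ δ1) :
    ∃ (a σ2 : ℝ) (g g2 : State v → ℝ) (C : ℝ), 0 < σ2 ∧ (∀ y, |g y| ≤ C) ∧ (∀ y, |g2 y| ≤ C) ∧
      (∀ y, avg q (incr a g) y = 0) ∧ ∀ y, avg q (incrSq a σ2 g g2) y = 0 := by
  have hq01 : ∀ y, 0 ≤ q y ∧ q y ≤ 1 := fun y => ⟨by linarith [hq y], by linarith [hq y]⟩
  obtain ⟨h, H, h1, hH, hL⟩ := exists_drift_function hδ2 hδ1 hq
  obtain ⟨a, g, C, hgC, hg0, hg, -⟩ := exists_poisson_solution hq01 h1 hH hL (f := q) (c := 1)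
    (fun y => abs_le.2 ⟨by linarith [hq01 y], (hq01 y).2⟩)
  have hincr : ∀ y, avg q (incr a g) y = 0 := fun y => by
    have := hg y
    simp only [avg, incr, Bool.toNat_true, Bool.toNat_false] at this ⊢
    push_cast
    linarith
  have hincr_le : ∀ y b, |incr a g y b| ≤ 1 + |a| + 2 * C := fun y b => by
    have h1 := abs_le.1 (hgC (nextState y b))
    have h2 := abs_le.1 (hgC y)
    have h3 := neg_abs_le a
    have h4 := le_abs_self a
    rw [incr, abs_le]
    cases b <;> simp only [Bool.toNat_true, Bool.toNat_false] <;> push_cast <;>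
      constructor <;> linarith
  obtain ⟨m, g2, C2, hg2C, hg20, hg2, hg2pos⟩ := exists_poisson_solution hq01 h1 hH hL
    (f := avg q fun y b => incr a g y b ^ 2 / 2) (c := (1 + |a| + 2 * C) ^ 2 / 2)
    (fun y => abs_avg_le (hq01 y) fun b => by
      rw [abs_of_nonneg (by positivity), ← sq_abs]
      have := hincr_le y b
      gcongr)
  have hs0 : ∀ y, 0 ≤ avg q (fun y b => incr a g y b ^ 2 / 2) y := fun y => by
    rw [← avg_const q 0 y]
    exact avg_mono (hq01 y) fun b => by positivity
  obtain ⟨hm0, hmg⟩ := hg2pos hs0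
  have hm : m ≠ 0 := by
    intro hm
    have hg2nn := hmg hm
    -- if the variance vanished, the increments would vanish along the excursions from `y₀`
    have hprop : ∀ y, g2 y = 0 → g2 (nextState y false) = 0 ∧ incr a g y true = 0 ∧
        incr a g y false = 0 := by
      intro y hy
      have e := hg2 y
      rw [hy, hm] at e
      simp only [avg] at e
      have q1 : 0 < q y := by linarith [hq y]
      have q2 : 0 < 1 - q y := by linarith [hq y]
      have t1 : 0 ≤ q y * (incr a g y true ^ 2 / 2) := by positivity
      have t2 : 0 ≤ (1 - q y) * (incr a g y false ^ 2 / 2) := by positivity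
      have t3 : 0 ≤ q y * g2 (nextState y true) := mul_nonneg q1.le (hg2nn _)
      have t4 : 0 ≤ (1 - q y) * g2 (nextState y false) := mul_nonneg q2.le (hg2nn _)
      have z1 : q y * (incr a g y true ^ 2 / 2) = 0 := by linarith
      have z2 : (1 - q y) * (incr a g y false ^ 2 / 2) = 0 := by linarith
      have z4 : (1 - q y) * g2 (nextState y false) = 0 := by linarith
      refine ⟨(mul_eq_zero.1 z4).resolve_left q2.ne', ?_, ?_⟩
      · simpa using (mul_eq_zero.1 z1).resolve_left q1.ne'
      · simpa using (mul_eq_zero.1 z2).resolve_left q2.ne'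
    have hline : ∀ k, g2 (k, fun _ => false) = 0 := by
      intro k
      induction k with
      | zero => exact hg20
      | succ k ih => exact (hprop _ ih).1
    have hzero : ∀ k, g (k + 1, fun _ => false) = g (k, fun _ => false) + a := fun k => by
      have := (hprop _ (hline k)).2.2
      simp only [incr, nextState, Bool.toNat_false] at this
      push_cast at this
      linarith
    have hone : ∀ k, v - 1 ≤ k → g (k, fun _ => false) = 1 - a := fun k hk => by
      have := (hprop _ (hline k)).2.1
      rw [incr, nextState_true_eq_baseState (y := (k, fun _ => false)) hk, hg0] at this
      simp only [Bool.toNat_true] at this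
      push_cast at this
      linarith
    have ha : a = 0 := by
      linarith [hone _ le_rfl, hone (v - 1 + 1) (Nat.le_succ _), hzero (v - 1)]
    have hconst : ∀ k, g (k, fun _ => false) = 0 := by
      intro k
      induction k with
      | zero => exact hg0
      | succ k ih => rw [hzero, ih, ha, zero_add]
    linarith [hone _ le_rfl, hconst (v - 1)]
  refine ⟨a, 2 * m, g, g2, max C C2, by positivity, fun y => (hgC y).trans (le_max_left _ _),
    fun y => (hg2C y).trans (le_max_right _ _), hincr, fun y => ?_⟩
  have := hg2 y
  simp only [avg, incrSq] at this ⊢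
  linarith

end StateSpace

section Chain

attribute [local instance] VLMC.mΩ VLMC.hprob

variable {v : ℕ} {p : ℕ → (Fin (v - 1) → Bool) → ℝ} (S : VLMC v p)

/-- The first `n` appended letters. -/
def hist (n : ℕ) (ω : S.Ω) : Fin n → Bool := fun i => S.X (i.1 + 1) ω

/-- The state of the chain at time `n`. -/
def Y (n : ℕ) (ω : S.Ω) : State v :=
  (((n : ℤ) - S.mpos ω n).toNat, fun j => S.cfg ω (S.mpos ω n - ((v : ℤ) - 1) + (j.1 : ℤ)))

/-- The probability of appending `1` in a given state. -/
def prob (_S : VLMC v p) (y : State v) : ℝ := p y.1 y.2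

lemma mpos_eq {ω : S.Ω} {n : ℕ} {m : ℤ} (h1 : m ≤ n) (h2 : S.cfg ω m = true)
    (h3 : ∀ i : ℤ, m < i → i ≤ n → S.cfg ω i = false) : S.mpos ω n = m := by
  obtain ⟨k1, k2, k3⟩ := S.hmpos ω n
  rcases lt_trichotomy (S.mpos ω n) m with h | h | h
  · rw [k3 m h h1] at h2; exact absurd h2 (by simp)
  · exact h
  · rw [h3 _ h k1] at k2; exact absurd k2 (by simp)

lemma cfg_natCast_succ (ω : S.Ω) (n : ℕ) : S.cfg ω ((n : ℤ) + 1) = S.X (n + 1) ω := by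
  rw [S.hcfg, if_neg (by omega)]
  rfl

lemma mpos_succ_of_true {ω : S.Ω} {n : ℕ} (h : S.X (n + 1) ω = true) :
    S.mpos ω (n + 1) = (n : ℤ) + 1 :=
  S.mpos_eq (by push_cast; rfl) (by rw [cfg_natCast_succ, h]) fun i h1 h2 => by
    push_cast at h2; omega

lemma mpos_succ_of_false {ω : S.Ω} {n : ℕ} (h : S.X (n + 1) ω = false) :
    S.mpos ω (n + 1) = S.mpos ω n := by
  obtain ⟨k1, k2, k3⟩ := S.hmpos ω n
  refine S.mpos_eq (by push_cast; omega) k2 fun i h1 h2 => ?_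
  rcases (show i ≤ n ∨ i = (n : ℤ) + 1 by push_cast at h2; omega) with hi | rfl
  · exact k3 i h1 hi
  · rw [cfg_natCast_succ, h]

lemma Y_succ (n : ℕ) (ω : S.Ω) : S.Y (n + 1) ω = nextState (S.Y n ω) (S.X (n + 1) ω) := by
  obtain ⟨k1, k2, k3⟩ := S.hmpos ω n
  have hv := S.hv
  cases hX : S.X (n + 1) ω
  · refine Prod.ext ?_ (funext fun j => ?_)
    · simp only [Y, nextState, S.mpos_succ_of_false hX]
      push_cast
      omega
    · simp only [Y, nextState, S.mpos_succ_of_false hX]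
  · refine Prod.ext ?_ (funext fun j => ?_)
    · simp only [Y, nextState, S.mpos_succ_of_true hX]
      push_cast
      omega
    · have hj := j.2
      have hY : ((S.Y n ω).1 : ℤ) = n - S.mpos ω n := by
        simp only [Y]
        omega
      change S.cfg ω (S.mpos ω (n + 1) - ((v : ℤ) - 1) + (j.1 : ℤ)) =
        if h : j.1 + (S.Y n ω).1 + 1 < v - 1 then
          S.cfg ω (S.mpos ω n - ((v : ℤ) - 1) + ((j.1 + (S.Y n ω).1 + 1 : ℕ) : ℤ))
        else decide (j.1 + (S.Y n ω).1 + 1 = v - 1)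
      rw [S.mpos_succ_of_true hX]
      split_ifs with h
      · congr 1
        push_cast
        omega
      · by_cases h' : j.1 + (S.Y n ω).1 + 1 = v - 1
        · rw [decide_eq_true h', ← k2]
          congr 1
          omega
        · rw [decide_eq_false h']
          exact k3 _ (by omega) (by omega)

lemma Y_zero (ω ω' : S.Ω) : S.Y 0 ω = S.Y 0 ω' := by
  have hcfg : ∀ i : ℤ, i ≤ 0 → S.cfg ω i = S.cfg ω' i := fun i hi => by
    rw [S.hcfg, S.hcfg, if_pos hi, if_pos hi]
  obtain ⟨k1, k2, k3⟩ := S.hmpos ω' 0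
  have hm : S.mpos ω 0 = S.mpos ω' 0 :=
    S.mpos_eq k1 (by rw [hcfg _ (by simpa using k1), k2])
      fun i h1 h2 => by rw [hcfg _ (by simpa using h2), k3 i h1 h2]
  have hv := S.hv
  have k1' : S.mpos ω' 0 ≤ 0 := by simpa using k1
  refine Prod.ext ?_ (funext fun j => ?_)
  · simp only [Y, hm]
  · simp only [Y, hm]
    exact hcfg _ (by omega)

lemma hitY0_iff (ω : S.Ω) (n : ℕ) : S.hitY0 ω n ↔ S.Y n ω = baseState v := by
  obtain ⟨k1, -, -⟩ := S.hmpos ω n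
  constructor
  · rintro ⟨h1, h2⟩
    refine Prod.ext ?_ (funext fun j => ?_)
    · simp [Y, baseState, h1]
    · simp only [Y, baseState, h1]
      exact h2 j
  · intro h
    have h1 : S.mpos ω n = n := by
      have := congrArg Prod.fst h
      simp only [Y, baseState] at this
      omega
    refine ⟨h1, fun j => ?_⟩
    have := congrFun (congrArg Prod.snd h) j
    simpa only [Y, baseState, h1] using this

lemma X_eq_of_hist_eq {n : ℕ} {ω ω' : S.Ω} (h : S.hist n ω = S.hist n ω') {k : ℕ} (h1 : 1 ≤ k)
    (h2 : k ≤ n) : S.X k ω = S.X k ω' := by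
  have := congrFun h ⟨k - 1, by omega⟩
  simpa only [hist, Nat.sub_add_cancel h1] using this

lemma hist_eq_of_le {m n : ℕ} (hmn : m ≤ n) {ω ω' : S.Ω} (h : S.hist n ω = S.hist n ω') :
    S.hist m ω = S.hist m ω' :=
  funext fun i => S.X_eq_of_hist_eq h (Nat.le_add_left _ _) (by omega)

lemma factorsThrough_Y (n : ℕ) : Function.FactorsThrough (S.Y n) (S.hist n) := by
  induction n with
  | zero => exact fun ω ω' _ => S.Y_zero ω ω'
  | succ n ih =>
    intro ω ω' h
    rw [Y_succ, Y_succ, ih (S.hist_eq_of_le n.le_succ h),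
      S.X_eq_of_hist_eq h (Nat.le_add_left _ _) le_rfl]

lemma factorsThrough_R (n : ℕ) : Function.FactorsThrough (S.R n) (S.hist n) := fun ω ω' h =>
  Finset.sum_congr rfl fun k hk => by
    rw [S.X_eq_of_hist_eq h (Finset.mem_Icc.1 hk).1 (Finset.mem_Icc.1 hk).2]

lemma R_succ (n : ℕ) (ω : S.Ω) : S.R (n + 1) ω = S.R n ω + (S.X (n + 1) ω).toNat :=
  Finset.sum_Icc_succ_top (Nat.le_add_left _ _) _

lemma R_zero (ω : S.Ω) : S.R 0 ω = 0 := by simp [R]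

lemma measurable_hist (n : ℕ) : Measurable (S.hist n) :=
  measurable_pi_lambda _ fun _ => S.hXmeas _

lemma nonempty_Ω : Nonempty S.Ω := nonempty_of_isProbabilityMeasure S.P

variable {S} in
lemma measurable_of_factorsThrough {n : ℕ} {G : S.Ω → ℝ}
    (hG : Function.FactorsThrough G (S.hist n)) : Measurable G := by
  have := S.nonempty_Ω
  obtain ⟨Φ, rfl⟩ := (Function.factorsThrough_iff G).1 hG
  exact (measurable_of_finite Φ).comp (S.measurable_hist n)

variable {S} in
lemma integrable_of_factorsThrough {n : ℕ} {G : S.Ω → ℝ}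
    (hG : Function.FactorsThrough G (S.hist n)) : Integrable G S.P := by
  have hm := measurable_of_factorsThrough hG
  have := S.nonempty_Ω
  obtain ⟨Φ, rfl⟩ := (Function.factorsThrough_iff G).1 hG
  refine Integrable.of_bound hm.aestronglyMeasurable (∑ b, ‖Φ b‖) (ae_of_all _ fun ω => ?_)
  exact Finset.single_le_sum (f := fun b => ‖Φ b‖) (fun _ _ => norm_nonneg _)
    (Finset.mem_univ (S.hist n ω))

variable {S}

/-- The transition rule in terms of the state of the chain. -/
lemma measureReal_hist_eq_and_true (hp : ∀ y, 0 ≤ S.prob y) (n : ℕ) (ω₀ : S.Ω) :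
    S.P.real {ω | S.hist n ω = S.hist n ω₀ ∧ S.X (n + 1) ω = true} =
      S.prob (S.Y n ω₀) * S.P.real {ω | S.hist n ω = S.hist n ω₀} := by
  have h := S.htrans n (S.hist n ω₀) (S.Y n ω₀).1 (S.Y n ω₀).2 fun ω hω => by
    have hY : S.Y n ω = S.Y n ω₀ := S.factorsThrough_Y n (funext hω)
    have hm := (S.hmpos ω n).1
    constructor
    · rw [← hY]
      simp only [Y]
      omega
    · intro j
      rw [← hY]
      rfl
  have e1 : {ω | S.hist n ω = S.hist n ω₀ ∧ S.X (n + 1) ω = true} =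
      {ω | (∀ i : Fin n, S.X (i.1 + 1) ω = S.hist n ω₀ i) ∧ S.X (n + 1) ω = true} := by
    ext ω
    exact and_congr_left fun _ => funext_iff
  have e2 : {ω | S.hist n ω = S.hist n ω₀} =
      {ω | ∀ i : Fin n, S.X (i.1 + 1) ω = S.hist n ω₀ i} := by
    ext ω
    exact funext_iff
  rw [e1, e2, measureReal_def, h, ENNReal.toReal_mul, ENNReal.toReal_ofReal (show 0 ≤ p _ _ from hp (S.Y n ω₀))]
  rfl

/-- One-step conditioning: averaging over the letter appended at time `n + 1`. -/
lemma integral_appended (hp : ∀ y, 0 ≤ S.prob y) (n : ℕ) {F : S.Ω → Bool → ℝ}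
    (hF : ∀ b, Function.FactorsThrough (fun ω => F ω b) (S.hist n)) :
    ∫ ω, F ω (S.X (n + 1) ω) ∂S.P =
      ∫ ω, (S.prob (S.Y n ω) * F ω true + (1 - S.prob (S.Y n ω)) * F ω false) ∂S.P := by
  classical
  have := S.nonempty_Ω
  obtain ⟨y, hy⟩ := (Function.factorsThrough_iff (S.Y n)).1 (S.factorsThrough_Y n)
  obtain ⟨Φ, hΦ⟩ : ∃ Φ : Bool → (Fin n → Bool) → ℝ, ∀ b ω, F ω b = Φ b (S.hist n ω) := by
    choose Φ hΦ using fun b => (Function.factorsThrough_iff fun ω => F ω b).1 (hF b)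
    exact ⟨Φ, fun b ω => congrFun (hΦ b) ω⟩
  have hyω : ∀ ω, S.Y n ω = y (S.hist n ω) := congrFun hy
  have hV := S.measurable_hist n
  have hVX : Measurable fun ω => (S.hist n ω, S.X (n + 1) ω) := hV.prodMk (S.hXmeas _)
  simp only [hΦ, hyω]
  have hL : ∫ ω, Φ (S.X (n + 1) ω) (S.hist n ω) ∂S.P =
      ∑ x : (Fin n → Bool) × Bool,
        S.P.real {ω | S.hist n ω = x.1 ∧ S.X (n + 1) ω = x.2} * Φ x.2 x.1 := by
    rw [← integral_map (f := fun x : (Fin n → Bool) × Bool => Φ x.2 x.1) hVX.aemeasurable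
      (measurable_of_finite _).aestronglyMeasurable, integral_fintype (Integrable.of_finite)]
    refine Finset.sum_congr rfl fun x _ => ?_
    rw [map_measureReal_apply hVX (measurableSet_singleton _), smul_eq_mul]
    congr 2
    ext ω
    exact Prod.ext_iff
  have hR : ∫ ω, (S.prob (y (S.hist n ω)) * Φ true (S.hist n ω) +
        (1 - S.prob (y (S.hist n ω))) * Φ false (S.hist n ω)) ∂S.P =
      ∑ x : Fin n → Bool, S.P.real {ω | S.hist n ω = x} *
        (S.prob (y x) * Φ true x + (1 - S.prob (y x)) * Φ false x) := by
    rw [← integral_map (f := fun x : Fin n → Bool =>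
        S.prob (y x) * Φ true x + (1 - S.prob (y x)) * Φ false x) hV.aemeasurable
      (measurable_of_finite _).aestronglyMeasurable, integral_fintype (Integrable.of_finite)]
    refine Finset.sum_congr rfl fun x _ => ?_
    rw [map_measureReal_apply hV (measurableSet_singleton _), smul_eq_mul]
    rfl
  rw [hL, hR, Fintype.sum_prod_type]
  refine Finset.sum_congr rfl fun x _ => ?_
  rw [Fintype.sum_bool]
  have hsplit : S.P.real {ω | S.hist n ω = x} =
      S.P.real {ω | S.hist n ω = x ∧ S.X (n + 1) ω = true} +
        S.P.real {ω | S.hist n ω = x ∧ S.X (n + 1) ω = false} := by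
    rw [← measureReal_inter_add_sdiff (s := {ω | S.hist n ω = x}) (t := {ω | S.X (n + 1) ω = true})
      (measurableSet_eq_fun (S.hXmeas _) measurable_const)]
    congr 2
    ext ω
    simp
  have htrue : S.P.real {ω | S.hist n ω = x ∧ S.X (n + 1) ω = true} =
      S.prob (y x) * S.P.real {ω | S.hist n ω = x} := by
    by_cases hx : ∃ ω₀, S.hist n ω₀ = x
    · obtain ⟨ω₀, rfl⟩ := hx
      rw [← hyω]
      exact measureReal_hist_eq_and_true hp n ω₀
    · have h0 : {ω | S.hist n ω = x} = ∅ := Set.eq_empty_of_forall_notMem fun ω hω => hx ⟨ω, hω⟩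
      have h0' : {ω | S.hist n ω = x ∧ S.X (n + 1) ω = true} = ∅ :=
        Set.eq_empty_of_forall_notMem fun ω hω => hx ⟨ω, hω.1⟩
      rw [h0, h0']
      simp
  have hfalse : S.P.real {ω | S.hist n ω = x ∧ S.X (n + 1) ω = false} =
      (1 - S.prob (y x)) * S.P.real {ω | S.hist n ω = x} := by linarith
  rw [htrue, hfalse]
  ring


lemma abs_exp_sub_second_order_le {K θ D E : ℝ} (hK : 1 ≤ K) (hD : |D| ≤ K) (hE : |E| ≤ K)
    (hθ : 2 * K * |θ| ≤ 1) :
    |Real.exp (θ * D + θ ^ 2 * E) - 1 - θ * D - θ ^ 2 * (D ^ 2 / 2 + E)| ≤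
      4 * K ^ 3 * |θ| ^ 3 := by
  set t := |θ| with ht
  have ht0 : 0 ≤ t := abs_nonneg θ
  have ht1 : t ≤ 1 / 2 := by nlinarith
  have hx : |θ * D + θ ^ 2 * E| ≤ 3 / 2 * (K * t) := by
    refine (abs_add_le _ _).trans ?_
    rw [abs_mul, abs_mul, abs_pow, ← ht]
    have h1 : t * |D| ≤ t * K := by gcongr
    have h2 : t ^ 2 * |E| ≤ t ^ 2 * K := by gcongr
    have h3 : t * (t * K) ≤ 1 / 2 * (t * K) := by gcongr
    nlinarith
  have hKt : K * t ≤ 1 / 2 := by linarith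
  have hexp := Real.exp_bound (x := θ * D + θ ^ 2 * E) (by linarith) (n := 3) (by norm_num)
  have hsum : ∑ m ∈ Finset.range 3, (θ * D + θ ^ 2 * E) ^ m / (m.factorial : ℝ) =
      1 + (θ * D + θ ^ 2 * E) + (θ * D + θ ^ 2 * E) ^ 2 / 2 := by
    simp [Finset.sum_range_succ, Nat.factorial]
  rw [hsum] at hexp
  have hcube : |θ * D + θ ^ 2 * E| ^ 3 ≤ (3 / 2 * (K * t)) ^ 3 := by gcongr
  have hrem : |θ ^ 3 * D * E + θ ^ 4 * E ^ 2 / 2| ≤ 2 * K ^ 3 * t ^ 3 := by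
    refine (abs_add_le _ _).trans ?_
    simp only [abs_mul, abs_div, abs_pow, ← ht, Nat.abs_ofNat]
    have h1 : t ^ 3 * |D| * |E| ≤ t ^ 3 * K * K := by gcongr
    have h2 : t ^ 4 * |E| ^ 2 ≤ t ^ 4 * K ^ 2 := by gcongr
    have h3 : t ^ 3 * t * K ^ 2 ≤ t ^ 3 * 1 * K ^ 2 := by gcongr; linarith
    have h4 : t ^ 3 * K ^ 2 * 1 ≤ t ^ 3 * K ^ 2 * K := by gcongr
    nlinarith
  have hsplit : Real.exp (θ * D + θ ^ 2 * E) - 1 - θ * D - θ ^ 2 * (D ^ 2 / 2 + E) =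
      (Real.exp (θ * D + θ ^ 2 * E) -
        (1 + (θ * D + θ ^ 2 * E) + (θ * D + θ ^ 2 * E) ^ 2 / 2)) +
        (θ ^ 3 * D * E + θ ^ 4 * E ^ 2 / 2) := by ring
  rw [hsplit]
  refine (abs_add_le _ _).trans ?_
  norm_num [Nat.factorial] at hexp
  have hpos : 0 ≤ K ^ 3 * t ^ 3 := by positivity
  nlinarith

section Martingale

variable {q : State v → ℝ} {a σ2 C : ℝ} {g g2 : State v → ℝ}

/-- The drift of the logarithm of the exponential martingale at second order. -/
def expIncr (a σ2 : ℝ) (g g2 : State v → ℝ) (θ : ℝ) (y : State v) (b : Bool) : ℝ :=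
  θ * incr a g y b + θ ^ 2 * (g2 (nextState y b) - g2 y - σ2 / 2)

lemma abs_incr_le (hg : ∀ y, |g y| ≤ C) (y : State v) (b : Bool) :
    |incr a g y b| ≤ 1 + |a| + 2 * C := by
  have hb : |(b.toNat : ℝ)| ≤ 1 := by cases b <;> simp
  have h1 := abs_sub (b.toNat : ℝ) a
  have h2 := abs_sub (g (nextState y b)) (g y)
  have h3 := abs_add_le ((b.toNat : ℝ) - a) (g (nextState y b) - g y)
  simp only [incr]
  linarith [hg y, hg (nextState y b)]

lemma abs_avg_exp_expIncr_sub_one_le {K θ : ℝ} (hq : ∀ y, 0 ≤ q y ∧ q y ≤ 1)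
    (hg : ∀ y, |g y| ≤ C) (hg2 : ∀ y, |g2 y| ≤ C) (hσ : 0 < σ2)
    (h1 : ∀ y, avg q (incr a g) y = 0) (h2 : ∀ y, avg q (incrSq a σ2 g g2) y = 0)
    (hK : K = 1 + |a| + 2 * C + σ2) (hθ : 2 * K * |θ| ≤ 1) (y : State v) :
    |avg q (fun y b => Real.exp (expIncr a σ2 g g2 θ y b)) y - 1| ≤ 4 * K ^ 3 * |θ| ^ 3 := by
  have hC : 0 ≤ C := (abs_nonneg _).trans (hg y)
  have hK1 : 1 ≤ K := by rw [hK]; linarith [abs_nonneg a]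
  have hrem : avg q (fun y b => Real.exp (expIncr a σ2 g g2 θ y b)) y - 1 =
      avg q (fun y b => Real.exp (expIncr a σ2 g g2 θ y b) - 1 - θ * incr a g y b -
        θ ^ 2 * (incr a g y b ^ 2 / 2 + (g2 (nextState y b) - g2 y - σ2 / 2))) y := by
    have e1 := h1 y
    have e2 := h2 y
    simp only [avg, incrSq] at e1 e2 ⊢
    linear_combination θ * e1 + θ ^ 2 * e2
  rw [hrem]
  refine abs_avg_le (hq y) fun b => abs_exp_sub_second_order_le hK1 ?_ ?_ hθ
  · exact (abs_incr_le hg y b).trans (by rw [hK]; linarith)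
  · have e1 := abs_sub (g2 (nextState y b) - g2 y) (σ2 / 2)
    have e2 := abs_sub (g2 (nextState y b)) (g2 y)
    have e3 : |σ2 / 2| = σ2 / 2 := abs_of_pos (by linarith)
    rw [hK]
    linarith [hg2 y, hg2 (nextState y b), abs_nonneg a]

/-- The logarithm of the corrected exponential martingale. -/
def logMart (S : VLMC v p) (a σ2 : ℝ) (g g2 : State v → ℝ) (θ : ℝ) (n : ℕ) (ω : S.Ω) : ℝ :=
  θ * (S.R n ω - a * n + g (S.Y n ω)) + θ ^ 2 * (g2 (S.Y n ω) - n * (σ2 / 2))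

lemma logMart_succ (θ : ℝ) (n : ℕ) (ω : S.Ω) :
    S.logMart a σ2 g g2 θ (n + 1) ω =
      S.logMart a σ2 g g2 θ n ω + expIncr a σ2 g g2 θ (S.Y n ω) (S.X (n + 1) ω) := by
  simp only [logMart, expIncr, incr, R_succ, Y_succ]
  push_cast
  ring

lemma factorsThrough_logMart (θ : ℝ) (n : ℕ) :
    Function.FactorsThrough (S.logMart a σ2 g g2 θ n) (S.hist n) := fun ω ω' h => by
  simp only [logMart, S.factorsThrough_Y n h, S.factorsThrough_R n h]

lemma integral_exp_logMart_succ (hp : ∀ y, 0 ≤ S.prob y) (θ : ℝ) (n : ℕ) :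
    ∫ ω, Real.exp (S.logMart a σ2 g g2 θ (n + 1) ω) ∂S.P =
      ∫ ω, Real.exp (S.logMart a σ2 g g2 θ n ω) *
        avg S.prob (fun y b => Real.exp (expIncr a σ2 g g2 θ y b)) (S.Y n ω) ∂S.P := by
  simp only [logMart_succ, Real.exp_add]
  rw [integral_appended hp n
    (F := fun ω b => Real.exp (S.logMart a σ2 g g2 θ n ω) *
      Real.exp (expIncr a σ2 g g2 θ (S.Y n ω) b))]
  · refine integral_congr_ae (ae_of_all _ fun ω => ?_)
    simp only [avg]
    ring
  · intro b ω ω' h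
    simp only [S.factorsThrough_Y n h, factorsThrough_logMart θ n h]

lemma integral_exp_logMart_bounds {θ ε : ℝ} (hp : ∀ y, 0 ≤ S.prob y) (hε : ε ≤ 1)
    (hc : ∀ y, |avg S.prob (fun y b => Real.exp (expIncr a σ2 g g2 θ y b)) y - 1| ≤ ε) (n : ℕ) :
    (1 - ε) ^ n * ∫ ω, Real.exp (S.logMart a σ2 g g2 θ 0 ω) ∂S.P ≤
        ∫ ω, Real.exp (S.logMart a σ2 g g2 θ n ω) ∂S.P ∧
      ∫ ω, Real.exp (S.logMart a σ2 g g2 θ n ω) ∂S.P ≤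
        (1 + ε) ^ n * ∫ ω, Real.exp (S.logMart a σ2 g g2 θ 0 ω) ∂S.P := by
  have h_int : ∀ n, Integrable (fun ω => Real.exp (S.logMart a σ2 g g2 θ n ω)) S.P := fun n =>
    integrable_of_factorsThrough (n := n) fun ω ω' h => by
      simp only [factorsThrough_logMart θ n h]
  have hintc : ∀ n, Integrable (fun ω => Real.exp (S.logMart a σ2 g g2 θ n ω) *
      avg S.prob (fun y b => Real.exp (expIncr a σ2 g g2 θ y b)) (S.Y n ω)) S.P := fun n =>
    integrable_of_factorsThrough (n := n) fun ω ω' h => by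
      simp only [factorsThrough_logMart θ n h, S.factorsThrough_Y n h]
  have hε0 : 0 ≤ ε := (abs_nonneg _).trans (hc (baseState v))
  induction n with
  | zero => simp
  | succ n ih =>
    rw [integral_exp_logMart_succ hp]
    constructor
    · calc (1 - ε) ^ (n + 1) * ∫ ω, Real.exp (S.logMart a σ2 g g2 θ 0 ω) ∂S.P
          = (1 - ε) * ((1 - ε) ^ n * ∫ ω, Real.exp (S.logMart a σ2 g g2 θ 0 ω) ∂S.P) := by ring
        _ ≤ (1 - ε) * ∫ ω, Real.exp (S.logMart a σ2 g g2 θ n ω) ∂S.P :=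
          mul_le_mul_of_nonneg_left ih.1 (sub_nonneg.2 hε)
        _ = ∫ ω, (1 - ε) * Real.exp (S.logMart a σ2 g g2 θ n ω) ∂S.P :=
          (integral_const_mul _ _).symm
        _ ≤ _ := integral_mono ((h_int n).const_mul _) (hintc n) fun ω => by
          change (1 - ε) * Real.exp _ ≤ Real.exp _ * _
          rw [mul_comm]
          exact mul_le_mul_of_nonneg_left (by linarith [(abs_le.1 (hc (S.Y n ω))).1])
            (Real.exp_pos _).le
    · calc ∫ ω, Real.exp (S.logMart a σ2 g g2 θ n ω) *
              avg S.prob (fun y b => Real.exp (expIncr a σ2 g g2 θ y b)) (S.Y n ω) ∂S.P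
          ≤ ∫ ω, (1 + ε) * Real.exp (S.logMart a σ2 g g2 θ n ω) ∂S.P :=
            integral_mono (hintc n) ((h_int n).const_mul _) fun ω => by
              change Real.exp _ * _ ≤ (1 + ε) * Real.exp _
              rw [mul_comm]
              exact mul_le_mul_of_nonneg_right (by linarith [(abs_le.1 (hc (S.Y n ω))).2])
                (Real.exp_pos _).le
        _ = (1 + ε) * ∫ ω, Real.exp (S.logMart a σ2 g g2 θ n ω) ∂S.P := integral_const_mul _ _
        _ ≤ (1 + ε) * ((1 + ε) ^ n * ∫ ω, Real.exp (S.logMart a σ2 g g2 θ 0 ω) ∂S.P) :=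
          mul_le_mul_of_nonneg_left ih.2 (by linarith)
        _ = _ := by ring

lemma exp_neg_two_mul_le_one_sub {x : ℝ} (h0 : 0 ≤ x) (h1 : x ≤ 1 / 2) :
    Real.exp (-(2 * x)) ≤ 1 - x := by
  have h2 := Real.add_one_le_exp (2 * x)
  rw [Real.exp_neg, inv_le_comm₀ (Real.exp_pos _) (by linarith), inv_le_iff_one_le_mul₀ (by linarith)]
  nlinarith

/-- Second-order expansion of the cumulant generating function of `R n`, with explicit error. -/
lemma exists_cgf_bound (hq : ∀ y, 0 ≤ S.prob y ∧ S.prob y ≤ 1)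
    (hg : ∀ y, |g y| ≤ C) (hg2 : ∀ y, |g2 y| ≤ C) (hσ : 0 < σ2)
    (h1 : ∀ y, avg S.prob (incr a g) y = 0) (h2 : ∀ y, avg S.prob (incrSq a σ2 g g2) y = 0) :
    ∃ θ₀ C' : ℝ, 0 < θ₀ ∧ ∀ θ, |θ| ≤ θ₀ → ∀ n : ℕ,
      |ProbabilityTheory.cgf (fun ω => (S.R n ω : ℝ) - a * n) S.P θ - n * (θ ^ 2 * σ2 / 2)| ≤
        C' * (|θ| + n * |θ| ^ 3) := by
  have hC : 0 ≤ C := (abs_nonneg _).trans (hg (baseState v))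
  set K := 1 + |a| + 2 * C + σ2 with hK
  have hK1 : 1 ≤ K := by rw [hK]; linarith [abs_nonneg a]
  refine ⟨1 / (2 * K), 4 * C + 8 * K ^ 3, by positivity, fun θ hθ n => ?_⟩
  have hθK : 2 * K * |θ| ≤ 1 := by
    rwa [le_div_iff₀ (by positivity), mul_comm] at hθ
  set t := |θ| with ht
  have ht0 : 0 ≤ t := abs_nonneg θ
  have ht1 : t ≤ 1 := by nlinarith
  set ε := 4 * K ^ 3 * t ^ 3 with hε
  have hε0 : 0 ≤ ε := by positivity
  have hε1 : ε ≤ 1 / 2 := by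
    have h3 : (2 * K * t) ^ 3 ≤ 1 := pow_le_one₀ (by positivity) hθK
    rw [hε]
    nlinarith
  obtain ⟨hlow, hupp⟩ := integral_exp_logMart_bounds (S := S) (fun y => (hq y).1)
    (hε1.trans (by norm_num)) (abs_avg_exp_expIncr_sub_one_le hq hg hg2 hσ h1 h2 hK hθK) n
  have hcorr : ∀ y, |θ * g y + θ ^ 2 * g2 y| ≤ 2 * C * t := fun y => by
    refine (abs_add_le _ _).trans ?_
    rw [abs_mul, abs_mul, abs_pow, ← ht]
    have e1 : t * |g y| ≤ t * C := mul_le_mul_of_nonneg_left (hg y) ht0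
    have e2 : t ^ 2 * |g2 y| ≤ t ^ 2 * C := mul_le_mul_of_nonneg_left (hg2 y) (by positivity)
    have e3 : t * (t * C) ≤ 1 * (t * C) := mul_le_mul_of_nonneg_right ht1 (by positivity)
    nlinarith
  have hlog : ∀ n ω, S.logMart a σ2 g g2 θ n ω = θ * (S.R n ω - a * n) +
      (θ * g (S.Y n ω) + θ ^ 2 * g2 (S.Y n ω)) - n * (θ ^ 2 * σ2 / 2) := fun n ω => by
    simp only [logMart]; ring
  have h_int : ∀ n, Integrable (fun ω => Real.exp (S.logMart a σ2 g g2 θ n ω)) S.P := fun n =>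
    integrable_of_factorsThrough (n := n) fun ω ω' h => by
      simp only [factorsThrough_logMart θ n h]
  have hintR : Integrable (fun ω => Real.exp (θ * (S.R n ω - a * n))) S.P :=
    integrable_of_factorsThrough (n := n) fun ω ω' h => by
      simp only [S.factorsThrough_R n h]
  set M := ∫ ω, Real.exp (θ * (S.R n ω - a * n)) ∂S.P with hM
  have hzero : ∀ ω, S.logMart a σ2 g g2 θ 0 ω = θ * g (S.Y 0 ω) + θ ^ 2 * g2 (S.Y 0 ω) :=
    fun ω => by rw [hlog, R_zero]; simp
  have hzlow : Real.exp (-(2 * C * t)) ≤ ∫ ω, Real.exp (S.logMart a σ2 g g2 θ 0 ω) ∂S.P := by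
    have := integral_mono (integrable_const (Real.exp (-(2 * C * t)))) (h_int 0) fun ω => by
      change _ ≤ Real.exp _
      rw [hzero]
      exact Real.exp_le_exp.2 (abs_le.1 (hcorr _)).1
    simpa using this
  have hzupp : ∫ ω, Real.exp (S.logMart a σ2 g g2 θ 0 ω) ∂S.P ≤ Real.exp (2 * C * t) := by
    have := integral_mono (h_int 0) (integrable_const (Real.exp (2 * C * t))) fun ω => by
      change Real.exp _ ≤ _
      rw [hzero]
      exact Real.exp_le_exp.2 (abs_le.1 (hcorr _)).2
    simpa using this
  have hMlow : Real.exp (n * (θ ^ 2 * σ2 / 2) - 2 * C * t) *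
      ∫ ω, Real.exp (S.logMart a σ2 g g2 θ n ω) ∂S.P ≤ M := by
    rw [← integral_const_mul]
    refine integral_mono ((h_int n).const_mul _) hintR fun ω => ?_
    change Real.exp _ * Real.exp _ ≤ Real.exp _
    rw [← Real.exp_add, Real.exp_le_exp, hlog]
    linarith [(abs_le.1 (hcorr (S.Y n ω))).2]
  have hMupp : M ≤ Real.exp (n * (θ ^ 2 * σ2 / 2) + 2 * C * t) *
      ∫ ω, Real.exp (S.logMart a σ2 g g2 θ n ω) ∂S.P := by
    rw [← integral_const_mul]
    refine integral_mono hintR ((h_int n).const_mul _) fun ω => ?_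
    change Real.exp _ ≤ Real.exp _ * Real.exp _
    rw [← Real.exp_add, Real.exp_le_exp, hlog]
    linarith [(abs_le.1 (hcorr (S.Y n ω))).1]
  have hpowlow : Real.exp (-(n * (2 * ε))) ≤ (1 - ε) ^ n := by
    have := pow_le_pow_left₀ (Real.exp_pos _).le (exp_neg_two_mul_le_one_sub hε0 hε1) n
    rwa [← Real.exp_nat_mul, mul_neg] at this
  have hpowupp : (1 + ε) ^ n ≤ Real.exp (n * (2 * ε)) := by
    rw [Real.exp_nat_mul]
    refine pow_le_pow_left₀ (by linarith) ?_ n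
    linarith [Real.add_one_le_exp (2 * ε)]
  have hMlow' : Real.exp (n * (θ ^ 2 * σ2 / 2) - 2 * C * t - n * (2 * ε) - 2 * C * t) ≤ M := by
    refine le_trans ?_ hMlow
    rw [show n * (θ ^ 2 * σ2 / 2) - 2 * C * t - n * (2 * ε) - 2 * C * t =
      (n * (θ ^ 2 * σ2 / 2) - 2 * C * t) + (-(n * (2 * ε)) + -(2 * C * t)) by ring,
      Real.exp_add, Real.exp_add (-(n * (2 * ε)))]
    refine mul_le_mul_of_nonneg_left (le_trans ?_ hlow) (Real.exp_pos _).le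
    exact mul_le_mul hpowlow hzlow (Real.exp_pos _).le (pow_nonneg (by linarith) _)
  have hMupp' : M ≤ Real.exp (n * (θ ^ 2 * σ2 / 2) + 2 * C * t + n * (2 * ε) + 2 * C * t) := by
    refine hMupp.trans ?_
    rw [show n * (θ ^ 2 * σ2 / 2) + 2 * C * t + n * (2 * ε) + 2 * C * t =
      (n * (θ ^ 2 * σ2 / 2) + 2 * C * t) + (n * (2 * ε) + 2 * C * t) by ring,
      Real.exp_add _ (n * (2 * ε) + 2 * C * t), Real.exp_add (n * (2 * ε))]
    refine mul_le_mul_of_nonneg_left (hupp.trans ?_) (Real.exp_pos _).le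
    exact mul_le_mul hpowupp hzupp (integral_nonneg fun _ => (Real.exp_pos _).le)
      (Real.exp_pos _).le
  have hMpos : 0 < M := (Real.exp_pos _).trans_le hMlow'
  have hcgf : ProbabilityTheory.cgf (fun ω => (S.R n ω : ℝ) - a * n) S.P θ = Real.log M := rfl
  have l1 := (Real.le_log_iff_exp_le hMpos).2 hMlow'
  have l2 := (Real.log_le_iff_le_exp hMpos).2 hMupp'
  have hslack : 0 ≤ 4 * C * (n * t ^ 3) + 8 * K ^ 3 * t := by positivity
  have hsplit : (4 * C + 8 * K ^ 3) * (t + n * t ^ 3) =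
      4 * C * t + n * (2 * ε) + (4 * C * (n * t ^ 3) + 8 * K ^ 3 * t) := by rw [hε]; ring
  rw [hcgf, hsplit, abs_le]
  constructor <;> linarith

end Martingale

section Excursion

variable {a σ2 : ℝ} {g g2 : State v → ℝ}

lemma integral_mul_appended (hp : ∀ y, 0 ≤ S.prob y) (n : ℕ) {G : S.Ω → ℝ}
    (hG : Function.FactorsThrough G (S.hist n)) (K : State v → Bool → ℝ) :
    ∫ ω, G ω * K (S.Y n ω) (S.X (n + 1) ω) ∂S.P =
      ∫ ω, G ω * avg S.prob K (S.Y n ω) ∂S.P := by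
  rw [integral_appended hp n (F := fun ω b => G ω * K (S.Y n ω) b)]
  · refine integral_congr_ae (ae_of_all _ fun ω => ?_)
    simp only [avg]
    ring
  · intro b ω ω' h
    simp only [S.factorsThrough_Y n h, hG h]

/-- The number of visits to the base state during the time interval `[1, n]`. -/
def visits (S : VLMC v p) : ℕ → S.Ω → ℕ
  | 0, _ => 0
  | n + 1, ω => visits S n ω + if S.Y (n + 1) ω = baseState v then 1 else 0

lemma visits_succ (n : ℕ) (ω : S.Ω) :
    S.visits (n + 1) ω = S.visits n ω + if S.Y (n + 1) ω = baseState v then 1 else 0 := rfl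

lemma factorsThrough_visits (n : ℕ) : Function.FactorsThrough (S.visits n) (S.hist n) := by
  induction n with
  | zero => exact fun _ _ _ => rfl
  | succ n ih =>
    intro ω ω' h
    rw [visits_succ, visits_succ, ih (S.hist_eq_of_le n.le_succ h), S.factorsThrough_Y _ h]

lemma visits_mono (ω : S.Ω) : Monotone fun n => S.visits n ω :=
  monotone_nat_of_le_succ fun n => by
    change S.visits n ω ≤ S.visits (n + 1) ω
    rw [visits_succ]
    omega

lemma visits_eq_of_forall_ne {ω : S.Ω} {m n : ℕ} (hmn : m ≤ n)
    (h : ∀ i, m < i → i ≤ n → S.Y i ω ≠ baseState v) : S.visits n ω = S.visits m ω := by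
  induction n, hmn using Nat.le_induction with
  | base => rfl
  | succ n hn ih =>
    rw [visits_succ, if_neg (h _ (by omega) le_rfl), ih fun i h1 h2 => h i h1 (by omega), add_zero]

lemma T_succ_spec {ω : S.Ω} {k N : ℕ} (hk : S.visits (S.T k ω) ω = k) (hN : k < S.visits N ω) :
    S.T k ω < S.T (k + 1) ω ∧ S.T (k + 1) ω ≤ N ∧ S.Y (S.T (k + 1) ω) ω = baseState v ∧
      S.visits (S.T (k + 1) ω) ω = k + 1 ∧
      ∀ n, S.T k ω ≤ n → n < S.T (k + 1) ω → S.visits n ω = k := by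
  have hlt : S.T k ω < N := by
    by_contra! h
    have := S.visits_mono ω h
    simp only [hk] at this
    omega
  have hex : ∃ i, S.T k ω < i ∧ i ≤ N ∧ S.Y i ω = baseState v := by
    by_contra! h
    have := visits_eq_of_forall_ne hlt.le h
    omega
  obtain ⟨i, hi1, hi2, hi3⟩ := hex
  have hmem : i ∈ {n | S.T k ω < n ∧ S.hitY0 ω n} := ⟨hi1, (S.hitY0_iff ω i).2 hi3⟩
  obtain ⟨m1, m2⟩ := Nat.sInf_mem ⟨i, hmem⟩
  have hmin : ∀ j, S.T k ω < j → j < S.T (k + 1) ω → S.Y j ω ≠ baseState v := fun j h1 h2 h3 =>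
    Nat.notMem_of_lt_sInf h2 ⟨h1, (S.hitY0_iff ω j).2 h3⟩
  change S.T k ω < S.T (k + 1) ω at m1
  change S.hitY0 ω (S.T (k + 1) ω) at m2
  have hconst : ∀ n, S.T k ω ≤ n → n < S.T (k + 1) ω → S.visits n ω = k := fun n h1 h2 => by
    rw [visits_eq_of_forall_ne h1 fun i h3 h4 => hmin i h3 (h4.trans_lt h2), hk]
  refine ⟨m1, (Nat.sInf_le hmem).trans hi2, (S.hitY0_iff _ _).1 m2, ?_, hconst⟩
  obtain ⟨t, ht⟩ : ∃ t, S.T (k + 1) ω = t + 1 := ⟨S.T (k + 1) ω - 1, by omega⟩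
  rw [ht, visits_succ, hconst t (by omega) (by omega), ← ht, if_pos ((S.hitY0_iff _ _).1 m2)]

/-- Once two visits have occurred, the excursion between the first two visits is the set of times
with exactly one past visit. -/
lemma excursion_spec {ω : S.Ω} {N : ℕ} (hN : 2 ≤ S.visits N ω) :
    S.T 1 ω < S.T 2 ω ∧ S.T 2 ω ≤ N ∧ S.Y (S.T 1 ω) ω = baseState v ∧
      S.Y (S.T 2 ω) ω = baseState v ∧
      ∀ n, S.visits n ω = 1 ↔ S.T 1 ω ≤ n ∧ n < S.T 2 ω := by
  obtain ⟨-, -, y1, v1, c1⟩ := T_succ_spec (k := 0) (ω := ω) (N := N) rfl (by omega)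
  obtain ⟨l2, b2, y2, v2, c2⟩ := T_succ_spec (k := 1) (ω := ω) (N := N) v1 (by omega)
  refine ⟨l2, b2, y1, y2, fun n => ⟨fun h => ⟨?_, ?_⟩, fun h => c2 n h.1 h.2⟩⟩
  · by_contra! h'
    have := c1 n (Nat.zero_le _) h'
    omega
  · by_contra! h'
    have := S.visits_mono ω h'
    simp only [v2, h] at this
    omega

/-- Partial sums of `K` along the excursion between the first two visits. -/
def excSum (S : VLMC v p) (K : State v → Bool → ℝ) (N : ℕ) (ω : S.Ω) : ℝ :=
  ∑ n ∈ Finset.range N, if S.visits n ω = 1 then K (S.Y n ω) (S.X (n + 1) ω) else 0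

/-- The sum of `K` along the excursion between the first two visits. -/
def excTotal (S : VLMC v p) (K : State v → Bool → ℝ) (ω : S.Ω) : ℝ :=
  ∑ n ∈ Finset.Ico (S.T 1 ω) (S.T 2 ω), K (S.Y n ω) (S.X (n + 1) ω)

lemma excSum_succ (K : State v → Bool → ℝ) (N : ℕ) (ω : S.Ω) :
    S.excSum K (N + 1) ω = S.excSum K N ω +
      (if S.visits N ω = 1 then 1 else 0) * K (S.Y N ω) (S.X (N + 1) ω) := by
  rw [excSum, Finset.sum_range_succ, ite_mul, one_mul, zero_mul]
  rfl

lemma excSum_eq_excTotal (K : State v → Bool → ℝ) {ω : S.Ω} {N : ℕ} (hN : 2 ≤ S.visits N ω) :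
    S.excSum K N ω = S.excTotal K ω := by
  obtain ⟨-, h2, -, -, h⟩ := excursion_spec hN
  rw [excSum, excTotal, ← Finset.sum_filter]
  refine Finset.sum_congr ?_ fun _ _ => rfl
  ext n
  simp only [Finset.mem_filter, Finset.mem_range, Finset.mem_Ico, h]
  omega

lemma abs_excSum_le {K : State v → Bool → ℝ} {c : ℝ} (hK : ∀ y b, |K y b| ≤ c) (N : ℕ) (ω : S.Ω) :
    |S.excSum K N ω| ≤ c * S.excSum (fun _ _ => 1) N ω := by
  rw [excSum, excSum, Finset.mul_sum]
  refine (Finset.abs_sum_le_sum_abs _ _).trans (Finset.sum_le_sum fun n _ => ?_)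
  split_ifs
  · simpa using hK _ _
  · simp

lemma excSum_one_mono (ω : S.Ω) : Monotone fun N => S.excSum (fun _ _ => 1) N ω :=
  monotone_nat_of_le_succ fun N => by
    rw [excSum_succ]
    split_ifs <;> simp

lemma excSum_one_le (N : ℕ) (ω : S.Ω) : S.excSum (fun _ _ => 1) N ω ≤ N :=
  (Finset.sum_le_card_nsmul _ _ 1 fun n _ => by split_ifs <;> simp).trans_eq (by simp)

lemma excTotal_one (ω : S.Ω) :
    S.excTotal (fun _ _ => 1) ω = S.tau 2 ω := by
  simp [excTotal, tau]

lemma factorsThrough_excSum (K : State v → Bool → ℝ) (N : ℕ) :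
    Function.FactorsThrough (S.excSum K N) (S.hist N) := fun ω ω' h =>
  Finset.sum_congr rfl fun n hn => by
    have hn' := Finset.mem_range.1 hn
    rw [S.factorsThrough_Y n (S.hist_eq_of_le hn'.le h),
      S.factorsThrough_visits n (S.hist_eq_of_le hn'.le h),
      S.X_eq_of_hist_eq h (Nat.le_add_left _ _) hn']

lemma sum_Ico_incr {m n : ℕ} (hmn : m ≤ n) (ω : S.Ω) :
    ∑ k ∈ Finset.Ico m n, incr a g (S.Y k ω) (S.X (k + 1) ω) =
      ((∑ k ∈ Finset.Ioc m n, (S.X k ω).toNat : ℕ) : ℝ) - a * ((n : ℝ) - m) +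
        (g (S.Y n ω) - g (S.Y m ω)) := by
  induction n, hmn using Nat.le_induction with
  | base => simp
  | succ n hn ih =>
    rw [Finset.sum_Ico_succ_top hn, ih, Finset.sum_Ioc_succ_top hn, incr, Y_succ]
    push_cast
    ring

lemma sum_Ico_incrSq {m n : ℕ} (hmn : m ≤ n) (ω : S.Ω) :
    ∑ k ∈ Finset.Ico m n, incrSq a σ2 g g2 (S.Y k ω) (S.X (k + 1) ω) =
      (∑ k ∈ Finset.Ico m n, incr a g (S.Y k ω) (S.X (k + 1) ω) ^ 2) / 2 -
        σ2 / 2 * ((n : ℝ) - m) + (g2 (S.Y n ω) - g2 (S.Y m ω)) := by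
  induction n, hmn using Nat.le_induction with
  | base => simp
  | succ n hn ih =>
    rw [Finset.sum_Ico_succ_top hn, ih, Finset.sum_Ico_succ_top hn, incrSq, Y_succ]
    push_cast
    ring

lemma excTotal_incr {ω : S.Ω} {N : ℕ} (hN : 2 ≤ S.visits N ω) :
    S.excTotal (incr a g) ω = S.zeta 2 ω - a * S.tau 2 ω := by
  obtain ⟨h1, -, y1, y2, -⟩ := excursion_spec hN
  rw [excTotal, sum_Ico_incr h1.le, y1, y2, sub_self, add_zero, tau, Nat.cast_sub h1.le]
  rfl

lemma excTotal_incrSq {ω : S.Ω} {N : ℕ} (hN : 2 ≤ S.visits N ω) :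
    S.excTotal (incrSq a σ2 g g2) ω =
      S.excTotal (fun y b => incr a g y b ^ 2) ω / 2 - σ2 / 2 * S.tau 2 ω := by
  obtain ⟨h1, -, y1, y2, -⟩ := excursion_spec hN
  rw [excTotal, sum_Ico_incrSq h1.le, y1, y2, sub_self, add_zero, tau, Nat.cast_sub h1.le]
  rfl

lemma integral_excSum_eq_zero (hp : ∀ y, 0 ≤ S.prob y) {K : State v → Bool → ℝ}
    (hK : ∀ y, avg S.prob K y = 0) (N : ℕ) : ∫ ω, S.excSum K N ω ∂S.P = 0 := by
  induction N with
  | zero => simp [excSum]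
  | succ N ih =>
    have hA : Function.FactorsThrough (fun ω => if S.visits N ω = 1 then (1 : ℝ) else 0)
        (S.hist N) := fun ω ω' h => by simp only [S.factorsThrough_visits N h]
    have h_int : Integrable (fun ω => (if S.visits N ω = 1 then (1 : ℝ) else 0) *
        K (S.Y N ω) (S.X (N + 1) ω)) S.P :=
      integrable_of_factorsThrough (n := N + 1) fun ω ω' h => by
        have h' := S.hist_eq_of_le N.le_succ h
        simp only [S.factorsThrough_visits N h', S.factorsThrough_Y N h',
          S.X_eq_of_hist_eq h (Nat.le_add_left _ _) le_rfl]
    simp only [excSum_succ]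
    rw [integral_add (integrable_of_factorsThrough (factorsThrough_excSum K N)) h_int, ih,
      integral_mul_appended hp N hA]
    simp [hK]

lemma integral_excSum_sq (hp : ∀ y, 0 ≤ S.prob y) {K : State v → Bool → ℝ}
    (hK : ∀ y, avg S.prob K y = 0) (N : ℕ) :
    ∫ ω, S.excSum K N ω ^ 2 ∂S.P = ∫ ω, S.excSum (fun y b => K y b ^ 2) N ω ∂S.P := by
  induction N with
  | zero => simp [excSum]
  | succ N ih =>
    have hcross : Function.FactorsThrough
        (fun ω => 2 * S.excSum K N ω * if S.visits N ω = 1 then (1 : ℝ) else 0) (S.hist N) :=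
      fun ω ω' h => by simp only [S.factorsThrough_visits N h, factorsThrough_excSum K N h]
    have hI1 : Integrable (fun ω => S.excSum K N ω ^ 2) S.P :=
      integrable_of_factorsThrough (n := N) fun ω ω' h => by
        simp only [factorsThrough_excSum K N h]
    have hI2 : Integrable (fun ω => (2 * S.excSum K N ω * if S.visits N ω = 1 then (1 : ℝ) else 0) *
        K (S.Y N ω) (S.X (N + 1) ω)) S.P :=
      integrable_of_factorsThrough (n := N + 1) fun ω ω' h => by
        have h' := S.hist_eq_of_le N.le_succ h
        simp only [S.factorsThrough_visits N h', S.factorsThrough_Y N h',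
          factorsThrough_excSum K N h', S.X_eq_of_hist_eq h (Nat.le_add_left _ _) le_rfl]
    have hI3 : Integrable (fun ω => (if S.visits N ω = 1 then (1 : ℝ) else 0) *
        K (S.Y N ω) (S.X (N + 1) ω) ^ 2) S.P :=
      integrable_of_factorsThrough (n := N + 1) fun ω ω' h => by
        have h' := S.hist_eq_of_le N.le_succ h
        simp only [S.factorsThrough_visits N h', S.factorsThrough_Y N h',
          S.X_eq_of_hist_eq h (Nat.le_add_left _ _) le_rfl]
    have hsq : ∀ ω, S.excSum K (N + 1) ω ^ 2 = S.excSum K N ω ^ 2 +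
        (2 * S.excSum K N ω * if S.visits N ω = 1 then (1 : ℝ) else 0) *
          K (S.Y N ω) (S.X (N + 1) ω) +
        (if S.visits N ω = 1 then (1 : ℝ) else 0) * K (S.Y N ω) (S.X (N + 1) ω) ^ 2 := fun ω => by
      rw [excSum_succ]
      split_ifs <;> ring
    have hzero : ∫ ω, (2 * S.excSum K N ω * if S.visits N ω = 1 then (1 : ℝ) else 0) *
        K (S.Y N ω) (S.X (N + 1) ω) ∂S.P = 0 := by
      rw [integral_mul_appended hp N hcross]
      simp [hK]
    simp only [hsq]
    rw [integral_add (hI1.fun_add hI2) hI3, integral_add hI1 hI2, hzero, add_zero, ih,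
      ← integral_add (integrable_of_factorsThrough (factorsThrough_excSum _ N)) hI3]
    simp only [excSum_succ]

end Excursion

section Regeneration

variable {a σ2 C : ℝ} {g g2 h : State v → ℝ} {H : ℝ}

lemma integral_pow_visits_le (hq : ∀ y, 0 ≤ S.prob y ∧ S.prob y ≤ 1)
    (h1 : ∀ y, 1 ≤ h y) (hH : ∀ y, h y ≤ H)
    (hL : ∀ y, 1 + killed S.prob nextState (baseState v) h y ≤ h y) (n : ℕ) :
    ∫ ω, (1 / (2 * H)) ^ S.visits n ω * h (S.Y n ω) ∂S.P ≤ (1 - 1 / (2 * H)) ^ n * H := by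
  have hH1 : 1 ≤ H := (h1 (baseState v)).trans (hH _)
  have h_int : ∀ n, Integrable (fun ω => (1 / (2 * H)) ^ S.visits n ω * h (S.Y n ω)) S.P := fun n =>
    integrable_of_factorsThrough (n := n) fun ω ω' hω => by
      simp only [S.factorsThrough_visits n hω, S.factorsThrough_Y n hω]
  have hρ : 0 ≤ 1 - 1 / (2 * H) := by
    rw [sub_nonneg, div_le_one (by positivity)]
    linarith
  induction n with
  | zero =>
    have := integral_mono (h_int 0) (integrable_const H) fun ω => by
      simpa [visits] using hH (S.Y 0 ω)
    simpa using this
  | succ n ih =>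
    have hpow : Function.FactorsThrough (fun ω => (1 / (2 * H)) ^ S.visits n ω) (S.hist n) :=
      fun ω ω' hω => by simp only [S.factorsThrough_visits n hω]
    obtain ⟨W, hW⟩ : ∃ W : State v → Bool → ℝ, ∀ y b, W y b =
        (if nextState y b = baseState v then 1 / (2 * H) else 1) * h (nextState y b) :=
      ⟨_, fun _ _ => rfl⟩
    have hstep : ∀ ω, (1 / (2 * H)) ^ S.visits (n + 1) ω * h (S.Y (n + 1) ω) =
        (1 / (2 * H)) ^ S.visits n ω * W (S.Y n ω) (S.X (n + 1) ω) := fun ω => by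
      rw [visits_succ, Y_succ, hW, pow_add, mul_assoc]
      split_ifs <;> simp
    have hdrift : ∀ y, avg S.prob W y ≤ (1 - 1 / (2 * H)) * h y := fun y => by
      have e1 : avg S.prob W y ≤ avg S.prob (fun (y : State v) b =>
            (if nextState y b = baseState v then 0 else h (nextState y b)) + 1 / 2) y := by
        refine avg_mono (hq y) fun b => ?_
        rw [hW]
        split_ifs
        · rw [zero_add, div_mul_eq_mul_div, one_mul, div_le_div_iff₀ (by positivity) two_pos]
          linarith [hH (nextState y b)]
        · linarith
      have e2 : avg S.prob (fun (y : State v) b =>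
            (if nextState y b = baseState v then 0 else h (nextState y b)) + 1 / 2) y =
          killed S.prob nextState (baseState v) h y + 1 / 2 := by
        simp only [killed, avg]
        split_ifs <;> ring
      have e3 : 1 / (2 * H) * h y ≤ 1 / 2 := by
        rw [div_mul_eq_mul_div, one_mul, div_le_div_iff₀ (by positivity) two_pos]
        linarith [hH y]
      linarith [hL y]
    simp only [hstep]
    rw [integral_mul_appended (fun y => (hq y).1) n hpow]
    calc _ ≤ ∫ ω, (1 - 1 / (2 * H)) * ((1 / (2 * H)) ^ S.visits n ω * h (S.Y n ω)) ∂S.P := by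
          refine integral_mono (integrable_of_factorsThrough (n := n) fun ω ω' hω => by
            simp only [S.factorsThrough_visits n hω, S.factorsThrough_Y n hω])
            ((h_int n).const_mul _) fun ω => ?_
          have := mul_le_mul_of_nonneg_left (hdrift (S.Y n ω))
            (show 0 ≤ (1 / (2 * H)) ^ S.visits n ω by positivity)
          refine this.trans_eq ?_
          ring
      _ = (1 - 1 / (2 * H)) * ∫ ω, (1 / (2 * H)) ^ S.visits n ω * h (S.Y n ω) ∂S.P :=
          integral_const_mul _ _
      _ ≤ (1 - 1 / (2 * H)) * ((1 - 1 / (2 * H)) ^ n * H) := mul_le_mul_of_nonneg_left ih hρ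
      _ = _ := by ring

/-- The second visit to the base state occurs at a time with geometric tails. -/
lemma exists_geometric_tail {δ1 δ2 : ℝ} (hδ2 : 0 < δ2) (hδ1 : δ1 < 1)
    (hq : ∀ y, δ2 ≤ S.prob y ∧ S.prob y ≤ δ1) :
    ∃ c ρ : ℝ, 0 ≤ ρ ∧ ρ < 1 ∧
      ∀ n, ∫ ω, (if S.visits n ω ≤ 1 then (1 : ℝ) else 0) ∂S.P ≤ c * ρ ^ n := by
  obtain ⟨h, H, h1, hH, hL⟩ := exists_drift_function hδ2 hδ1 hq
  have hq' : ∀ y, 0 ≤ S.prob y ∧ S.prob y ≤ 1 := fun y =>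
    ⟨hδ2.le.trans (hq y).1, (hq y).2.trans hδ1.le⟩
  have hH1 : 1 ≤ H := (h1 (baseState v)).trans (hH _)
  have hη1 : 1 / (2 * H) ≤ 1 := by
    rw [div_le_one (by positivity)]
    linarith
  have hη0 : 0 < 1 / (2 * H) := by positivity
  refine ⟨2 * H * H, 1 - 1 / (2 * H), by linarith, by linarith, fun n => ?_⟩
  calc ∫ ω, (if S.visits n ω ≤ 1 then (1 : ℝ) else 0) ∂S.P
      ≤ ∫ ω, 2 * H * ((1 / (2 * H)) ^ S.visits n ω * h (S.Y n ω)) ∂S.P := by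
        refine integral_mono (integrable_of_factorsThrough (n := n) fun ω ω' hω => by
          simp only [S.factorsThrough_visits n hω]) (integrable_of_factorsThrough (n := n)
          fun ω ω' hω => by simp only [S.factorsThrough_visits n hω, S.factorsThrough_Y n hω])
          fun ω => ?_
        have hpos : 0 ≤ 2 * H * ((1 / (2 * H)) ^ S.visits n ω * h (S.Y n ω)) :=
          mul_nonneg (by positivity) (mul_nonneg (by positivity) (one_pos.le.trans (h1 _)))
        dsimp only
        split_ifs with hv
        · have hpow : 1 / (2 * H) ≤ (1 / (2 * H)) ^ S.visits n ω := by
            simpa using pow_le_pow_of_le_one hη0.le hη1 hv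
          have hone : (1 : ℝ) = 2 * H * (1 / (2 * H) * 1) := by field_simp
          refine hone.trans_le (mul_le_mul_of_nonneg_left
            (mul_le_mul hpow (h1 _) zero_le_one (by positivity)) (by positivity))
        · exact hpos
    _ = 2 * H * ∫ ω, (1 / (2 * H)) ^ S.visits n ω * h (S.Y n ω) ∂S.P := integral_const_mul _ _
    _ ≤ 2 * H * ((1 - 1 / (2 * H)) ^ n * H) :=
        mul_le_mul_of_nonneg_left (integral_pow_visits_le hq' h1 hH hL n) (by positivity)
    _ = _ := by ring

variable {c ρ : ℝ}

lemma ae_exists_two_le_visits (hρ0 : 0 ≤ ρ) (hρ1 : ρ < 1)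
    (ht : ∀ n, ∫ ω, (if S.visits n ω ≤ 1 then (1 : ℝ) else 0) ∂S.P ≤ c * ρ ^ n) :
    ∀ᵐ ω ∂S.P, ∃ N, 2 ≤ S.visits N ω := by
  have hms : ∀ n, MeasurableSet {ω | S.visits n ω ≤ 1} := fun n => by
    have hm : Measurable fun ω => (S.visits n ω : ℝ) :=
      measurable_of_factorsThrough (n := n) fun ω ω' hω => by
        simp only [S.factorsThrough_visits n hω]
    convert measurableSet_le hm (measurable_const (a := (1 : ℝ))) using 3
    norm_cast
  have hle : ∀ n, S.P.real {ω | ¬ ∃ N, 2 ≤ S.visits N ω} ≤ c * ρ ^ n := fun n => by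
    have hsub : {ω | ¬ ∃ N, 2 ≤ S.visits N ω} ⊆ {ω | S.visits n ω ≤ 1} := fun ω hω => by
      have : ¬ 2 ≤ S.visits n ω := fun h' => hω ⟨n, h'⟩
      change S.visits n ω ≤ 1
      omega
    refine (measureReal_mono hsub).trans (le_of_eq_of_le ?_ (ht n))
    rw [← integral_indicator_one (hms n)]
    simp only [Set.indicator_apply, Set.mem_ofPred_eq, Pi.one_apply]
  have hlim : Tendsto (fun n : ℕ => c * ρ ^ n) atTop (nhds 0) := by
    simpa using (tendsto_pow_atTop_nhds_zero_of_lt_one hρ0 hρ1).const_mul c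
  have h0 := le_antisymm (ge_of_tendsto' hlim hle) measureReal_nonneg
  rw [measureReal_eq_zero_iff] at h0
  exact h0

lemma exists_integral_excSum_one_sq_le (hρ0 : 0 ≤ ρ) (hρ1 : ρ < 1)
    (ht : ∀ n, ∫ ω, (if S.visits n ω ≤ 1 then (1 : ℝ) else 0) ∂S.P ≤ c * ρ ^ n) :
    ∃ B : ℝ, ∀ N, ∫ ω, S.excSum (fun _ _ => 1) N ω ^ 2 ∂S.P ≤ B := by
  have hc : 0 ≤ c := by
    simpa using (integral_nonneg fun ω => by
      change (0 : ℝ) ≤ if S.visits 0 ω ≤ 1 then (1 : ℝ) else 0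
      split_ifs <;> simp).trans (ht 0)
  have hsum : Summable fun n : ℕ => (2 * (n : ℝ) + 1) * (c * ρ ^ n) := by
    have hρ : ‖ρ‖ < 1 := by rwa [Real.norm_of_nonneg hρ0]
    have s1 := (summable_pow_mul_geometric_of_norm_lt_one 1 hρ).mul_left (2 * c)
    have s2 := (summable_geometric_of_lt_one hρ0 hρ1).mul_left c
    refine (s1.add s2).congr fun n => ?_
    ring
  have hpartial : ∀ N, ∫ ω, S.excSum (fun _ _ => 1) N ω ^ 2 ∂S.P ≤
      ∑ n ∈ Finset.range N, (2 * (n : ℝ) + 1) * (c * ρ ^ n) := fun N => by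
    induction N with
    | zero => simp [excSum]
    | succ N ih =>
      have hI1 : Integrable (fun ω => S.excSum (fun _ _ => 1) N ω ^ 2) S.P :=
        integrable_of_factorsThrough (n := N) fun ω ω' hω => by
          simp only [factorsThrough_excSum _ N hω]
      have hI2 : Integrable (fun ω => (2 * (N : ℝ) + 1) *
          (if S.visits N ω ≤ 1 then (1 : ℝ) else 0)) S.P :=
        integrable_of_factorsThrough (n := N) fun ω ω' hω => by
          simp only [S.factorsThrough_visits N hω]
      have hI3 : Integrable (fun ω => S.excSum (fun _ _ => 1) (N + 1) ω ^ 2) S.P :=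
        integrable_of_factorsThrough (n := N + 1) fun ω ω' hω => by
          simp only [factorsThrough_excSum _ (N + 1) hω]
      rw [Finset.sum_range_succ]
      calc _ ≤ ∫ ω, (S.excSum (fun _ _ => 1) N ω ^ 2 + (2 * (N : ℝ) + 1) *
            (if S.visits N ω ≤ 1 then (1 : ℝ) else 0)) ∂S.P :=
            integral_mono hI3 (hI1.fun_add hI2) fun ω => by
              dsimp only
              rw [excSum_succ]
              have hN := S.excSum_one_le N ω
              split_ifs <;> first | omega | nlinarith
        _ = _ := integral_add hI1 hI2
        _ ≤ _ := by
          rw [integral_const_mul]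
          exact add_le_add ih (mul_le_mul_of_nonneg_left (ht N) (by positivity))
  exact ⟨_, fun N => (hpartial N).trans (hsum.sum_le_tsum _ fun n _ => by positivity)⟩

lemma tendsto_excSum (K : State v → Bool → ℝ) {ω : S.Ω} (hω : ∃ N, 2 ≤ S.visits N ω) :
    Tendsto (fun N => S.excSum K N ω) atTop (nhds (S.excTotal K ω)) := by
  obtain ⟨N, hN⟩ := hω
  refine tendsto_const_nhds.congr' ?_
  filter_upwards [eventually_ge_atTop N] with n hn
  exact (excSum_eq_excTotal K (hN.trans (S.visits_mono ω hn))).symm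

lemma excSum_one_le_tau {ω : S.Ω} (hω : ∃ N, 2 ≤ S.visits N ω) (N : ℕ) :
    S.excSum (fun _ _ => 1) N ω ≤ S.tau 2 ω := by
  rw [← excTotal_one]
  exact (S.excSum_one_mono ω).ge_of_tendsto (tendsto_excSum _ hω) N

lemma aestronglyMeasurable_excTotal (hae : ∀ᵐ ω ∂S.P, ∃ N, 2 ≤ S.visits N ω)
    (K : State v → Bool → ℝ) : AEStronglyMeasurable (S.excTotal K) S.P := by
  refine aestronglyMeasurable_of_tendsto_ae atTop (fun N =>
    (measurable_of_factorsThrough (factorsThrough_excSum K N)).aestronglyMeasurable) ?_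
  filter_upwards [hae] with ω hω using tendsto_excSum K hω

lemma integrable_tau_sq (hae : ∀ᵐ ω ∂S.P, ∃ N, 2 ≤ S.visits N ω) {B : ℝ}
    (hB : ∀ N, ∫ ω, S.excSum (fun _ _ => 1) N ω ^ 2 ∂S.P ≤ B) :
    Integrable (fun ω => (S.tau 2 ω : ℝ) ^ 2) S.P := by
  have hm : AEStronglyMeasurable (fun ω => (S.tau 2 ω : ℝ) ^ 2) S.P := by
    have := aestronglyMeasurable_excTotal hae fun _ _ => 1
    simp only [funext excTotal_one] at this
    exact this.pow 2
  have hmN : ∀ N, Measurable fun ω => ENNReal.ofReal (S.excSum (fun _ _ => 1) N ω ^ 2) := fun N =>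
    ((measurable_of_factorsThrough (factorsThrough_excSum _ N)).pow_const 2).ennreal_ofReal
  refine ⟨hm, ?_⟩
  rw [hasFiniteIntegral_iff_ofReal (ae_of_all _ fun ω => sq_nonneg _)]
  have hlim : ∀ᵐ ω ∂S.P, ENNReal.ofReal ((S.tau 2 ω : ℝ) ^ 2) =
      liminf (fun N => ENNReal.ofReal (S.excSum (fun _ _ => 1) N ω ^ 2)) atTop := by
    filter_upwards [hae] with ω hω
    rw [← excTotal_one]
    exact ((ENNReal.tendsto_ofReal ((tendsto_excSum _ hω).pow 2)).liminf_eq).symm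
  rw [lintegral_congr_ae hlim]
  refine (lintegral_liminf_le hmN).trans_lt (lt_of_le_of_lt ?_ (ENNReal.ofReal_lt_top (r := B)))
  refine liminf_le_of_le (by isBoundedDefault) fun b hb => ?_
  obtain ⟨N, hN⟩ := hb.exists
  refine hN.trans ?_
  rw [← ofReal_integral_eq_lintegral_ofReal (integrable_of_factorsThrough (n := N)
    fun ω ω' hω => by simp only [factorsThrough_excSum _ N hω]) (ae_of_all _ fun ω => sq_nonneg _)]
  exact ENNReal.ofReal_le_ofReal (hB N)

lemma integrable_tau (hae : ∀ᵐ ω ∂S.P, ∃ N, 2 ≤ S.visits N ω)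
    (hτ : Integrable (fun ω => (S.tau 2 ω : ℝ) ^ 2) S.P) :
    Integrable (fun ω => (S.tau 2 ω : ℝ)) S.P := by
  have hm := aestronglyMeasurable_excTotal hae fun _ _ => 1
  simp only [funext excTotal_one] at hm
  refine hτ.mono' hm (ae_of_all _ fun ω => ?_)
  rw [Real.norm_of_nonneg (Nat.cast_nonneg _)]
  exact_mod_cast Nat.le_self_pow two_ne_zero _

lemma norm_excSum_le {K : State v → Bool → ℝ} {C : ℝ} (hK : ∀ y b, |K y b| ≤ C) {ω : S.Ω}
    (hω : ∃ N, 2 ≤ S.visits N ω) (N : ℕ) : |S.excSum K N ω| ≤ C * S.tau 2 ω :=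
  (abs_excSum_le hK N ω).trans (mul_le_mul_of_nonneg_left (excSum_one_le_tau hω N)
    ((abs_nonneg _).trans (hK (baseState v) true)))

lemma tendsto_integral_excSum (hae : ∀ᵐ ω ∂S.P, ∃ N, 2 ≤ S.visits N ω)
    (hτ : Integrable (fun ω => (S.tau 2 ω : ℝ)) S.P) {K : State v → Bool → ℝ}
    (hK : ∀ y b, |K y b| ≤ C) :
    Tendsto (fun N => ∫ ω, S.excSum K N ω ∂S.P) atTop (nhds (∫ ω, S.excTotal K ω ∂S.P)) := by
  refine tendsto_integral_of_dominated_convergence (fun ω => C * S.tau 2 ω)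
    (fun N => (measurable_of_factorsThrough (factorsThrough_excSum K N)).aestronglyMeasurable)
    (hτ.const_mul C) (fun N => ?_) ?_
  · filter_upwards [hae] with ω hω using norm_excSum_le hK hω N
  · filter_upwards [hae] with ω hω using tendsto_excSum K hω

lemma tendsto_integral_excSum_sq (hae : ∀ᵐ ω ∂S.P, ∃ N, 2 ≤ S.visits N ω)
    (hτ : Integrable (fun ω => (S.tau 2 ω : ℝ) ^ 2) S.P) {K : State v → Bool → ℝ}
    (hK : ∀ y b, |K y b| ≤ C) :
    Tendsto (fun N => ∫ ω, S.excSum K N ω ^ 2 ∂S.P) atTop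
      (nhds (∫ ω, S.excTotal K ω ^ 2 ∂S.P)) := by
  refine tendsto_integral_of_dominated_convergence (fun ω => C ^ 2 * (S.tau 2 ω : ℝ) ^ 2)
    (fun N => ((measurable_of_factorsThrough
      (factorsThrough_excSum K N)).pow_const 2).aestronglyMeasurable)
    (hτ.const_mul (C ^ 2)) (fun N => ?_) ?_
  · filter_upwards [hae] with ω hω
    rw [norm_pow, Real.norm_eq_abs, ← mul_pow]
    exact pow_le_pow_left₀ (abs_nonneg _) (norm_excSum_le hK hω N) 2
  · filter_upwards [hae] with ω hω using (tendsto_excSum K hω).pow 2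

lemma integrable_excTotal (hae : ∀ᵐ ω ∂S.P, ∃ N, 2 ≤ S.visits N ω)
    (hτ : Integrable (fun ω => (S.tau 2 ω : ℝ)) S.P) {K : State v → Bool → ℝ}
    (hK : ∀ y b, |K y b| ≤ C) : Integrable (S.excTotal K) S.P := by
  refine (hτ.const_mul C).mono' (aestronglyMeasurable_excTotal hae K) ?_
  filter_upwards [hae] with ω hω
  exact le_of_tendsto' (tendsto_excSum K hω).abs fun N => norm_excSum_le hK hω N

/-- The regeneration constants coincide with the constants of the Poisson equations. -/
lemma a_eq_and_sigma2_eq {δ1 δ2 : ℝ} (hδ2 : 0 < δ2) (hδ1 : δ1 < 1)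
    (hq : ∀ y, δ2 ≤ S.prob y ∧ S.prob y ≤ δ1) (hg : ∀ y, |g y| ≤ C) (hg2 : ∀ y, |g2 y| ≤ C)
    (e1 : ∀ y, avg S.prob (incr a g) y = 0) (e2 : ∀ y, avg S.prob (incrSq a σ2 g g2) y = 0) :
    S.a = a ∧ S.sigma2 = σ2 := by
  obtain ⟨c, ρ, hρ0, hρ1, ht⟩ := exists_geometric_tail hδ2 hδ1 hq
  have hp : ∀ y, 0 ≤ S.prob y := fun y => hδ2.le.trans (hq y).1
  have hae := ae_exists_two_le_visits hρ0 hρ1 ht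
  obtain ⟨B, hB⟩ := exists_integral_excSum_one_sq_le hρ0 hρ1 ht
  have hτ2 := integrable_tau_sq hae hB
  have hτ := integrable_tau hae hτ2
  have hτpos : 0 < ∫ ω, (S.tau 2 ω : ℝ) ∂S.P := by
    have hone : ∫ _, (1 : ℝ) ∂S.P ≤ ∫ ω, (S.tau 2 ω : ℝ) ∂S.P := by
      refine integral_mono_ae (integrable_const _) hτ ?_
      filter_upwards [hae] with ω ⟨N, hN⟩
      have := (excursion_spec hN).1
      simp only [tau]
      exact_mod_cast (show 1 ≤ S.T 2 ω - S.T 1 ω by omega)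
    simp only [integral_const, probReal_univ, smul_eq_mul, mul_one] at hone
    linarith
  set D := 1 + |a| + 2 * C with hD
  have hincr : ∀ y b, |incr a g y b| ≤ D := fun y b => abs_incr_le hg y b
  have hincr2 : ∀ y b, |incr a g y b ^ 2| ≤ D ^ 2 := fun y b => by
    rw [abs_pow]
    exact pow_le_pow_left₀ (abs_nonneg _) (hincr y b) 2
  have hincrSq : ∀ y b, |incrSq a σ2 g g2 y b| ≤ D ^ 2 / 2 + |σ2 / 2| + 2 * C := fun y b => by
    have b1 := hincr2 y b
    have b2 := abs_le.1 (hg2 y)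
    have b3 := abs_le.1 (hg2 (nextState y b))
    have b4 := neg_abs_le (σ2 / 2)
    have b5 := le_abs_self (σ2 / 2)
    rw [abs_le] at b1 ⊢
    simp only [incrSq]
    constructor <;> linarith
  have hmean : ∫ ω, S.excTotal (incr a g) ω ∂S.P = 0 :=
    tendsto_nhds_unique (tendsto_integral_excSum hae hτ hincr)
      (by simp only [integral_excSum_eq_zero hp e1, tendsto_const_nhds])
  have hmean2 : ∫ ω, S.excTotal (incrSq a σ2 g g2) ω ∂S.P = 0 :=
    tendsto_nhds_unique (tendsto_integral_excSum hae hτ hincrSq)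
      (by simp only [integral_excSum_eq_zero hp e2, tendsto_const_nhds])
  have hvar : ∫ ω, S.excTotal (incr a g) ω ^ 2 ∂S.P =
      ∫ ω, S.excTotal (fun y b => incr a g y b ^ 2) ω ∂S.P :=
    tendsto_nhds_unique (tendsto_integral_excSum_sq hae hτ2 hincr)
      (by simpa only [integral_excSum_sq hp e1] using tendsto_integral_excSum hae hτ hincr2)
  have hζ : ∫ ω, (S.zeta 2 ω : ℝ) ∂S.P = a * ∫ ω, (S.tau 2 ω : ℝ) ∂S.P := by
    have hae' : (fun ω => (S.zeta 2 ω : ℝ)) =ᵐ[S.P]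
        fun ω => S.excTotal (incr a g) ω + a * S.tau 2 ω := by
      filter_upwards [hae] with ω ⟨N, hN⟩
      rw [excTotal_incr hN]
      ring
    rw [integral_congr_ae hae', integral_add (integrable_excTotal hae hτ hincr) (hτ.const_mul a),
      hmean, integral_const_mul, zero_add]
  have ha : S.a = a := by
    rw [VLMC.a, hζ]
    exact mul_div_cancel_right₀ _ hτpos.ne'
  refine ⟨ha, ?_⟩
  have hsq : ∫ ω, ((S.zeta 2 ω : ℝ) - S.a * S.tau 2 ω) ^ 2 ∂S.P =
      ∫ ω, S.excTotal (incr a g) ω ^ 2 ∂S.P := by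
    refine integral_congr_ae ?_
    filter_upwards [hae] with ω ⟨N, hN⟩
    rw [ha, excTotal_incr hN]
  have hbal : ∫ ω, S.excTotal (fun y b => incr a g y b ^ 2) ω ∂S.P =
      σ2 * ∫ ω, (S.tau 2 ω : ℝ) ∂S.P := by
    have hae' : S.excTotal (incrSq a σ2 g g2) =ᵐ[S.P] fun ω =>
        S.excTotal (fun y b => incr a g y b ^ 2) ω / 2 - σ2 / 2 * S.tau 2 ω := by
      filter_upwards [hae] with ω ⟨N, hN⟩ using excTotal_incrSq hN
    rw [integral_congr_ae hae', integral_sub ((integrable_excTotal hae hτ hincr2).div_const 2)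
      (hτ.const_mul _), integral_div, integral_const_mul] at hmean2
    linarith
  rw [sigma2, hsq, hvar, hbal]
  exact mul_div_cancel_right₀ _ hτpos.ne'

end Regeneration

end Chain

/-- Theorem 1.5(5): the moderate deviation principle: if
`κ_n/n → 0` and `κ_n/√n → ∞`, then `(R(n) - a n)/κ_n` satisfies the large deviation
principle with normalizing function `φ(n) = κ_n²/n` and rate function
`I(y) = y²/(2σ²)`. -/
theorem statement4 {v : ℕ} {p : ℕ → (Fin (v - 1) → Bool) → ℝ} (S : VLMC v p)
    (hA : ∃ δ1 δ2 : ℝ, S.CondA δ1 δ2)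
    (κ : ℕ → ℝ)
    (hκ1 : Filter.Tendsto (fun n : ℕ => κ n / n) Filter.atTop (nhds 0))
    (hκ2 : Filter.Tendsto (fun n : ℕ => κ n / Real.sqrt n) Filter.atTop Filter.atTop) :
    SatisfiesLDP S.P (fun n ω => ((S.R n ω : ℝ) - S.a * n) / κ n)
      (fun n => κ n ^ 2 / n)
      (fun y => ((y ^ 2 / (2 * S.sigma2) : ℝ) : EReal)) := by
  obtain ⟨δ1, δ2, -, hδ2, -, hδ1, hδ⟩ := hA
  have hq : ∀ y, δ2 ≤ S.prob y ∧ S.prob y ≤ δ1 := fun y => hδ y.1 y.2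
  have hq' : ∀ y, 0 ≤ S.prob y ∧ S.prob y ≤ 1 := fun y =>
    ⟨hδ2.le.trans (hq y).1, (hq y).2.trans hδ1.le⟩
  obtain ⟨a, σ2, g, g2, C, hσ, hg, hg2, e1, e2⟩ := exists_correctors hδ2 hδ1 hq
  obtain ⟨ha, hs⟩ := a_eq_and_sigma2_eq hδ2 hδ1 hq hg hg2 e1 e2
  obtain ⟨θ₀, C', hθ₀, hcgf⟩ := exists_cgf_bound hq' hg hg2 hσ e1 e2
  rw [ha, hs]
  have := S.hprob
  have hn0 : ∀ᶠ n : ℕ in atTop, 0 < (n : ℝ) := by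
    filter_upwards [eventually_gt_atTop 0] with n hn using Nat.cast_pos.2 hn
  have hκ0 : ∀ᶠ n in atTop, 0 < κ n := by
    filter_upwards [hκ2.eventually_gt_atTop 0, hn0] with n h hn
    exact (div_pos_iff_of_pos_right (Real.sqrt_pos.2 hn)).1 h
  have hκ : Tendsto κ atTop atTop := by
    have hsqrt : Tendsto (fun n : ℕ => Real.sqrt n) atTop atTop :=
      Real.tendsto_sqrt_atTop.comp tendsto_natCast_atTop_atTop
    refine (hκ2.atTop_mul_atTop₀ hsqrt).congr' ?_
    filter_upwards [hn0] with n hn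
    exact div_mul_cancel₀ _ (Real.sqrt_pos.2 hn).ne'
  have hφ : Tendsto (fun n : ℕ => κ n ^ 2 / n) atTop atTop := by
    refine ((tendsto_pow_atTop two_ne_zero).comp hκ2).congr fun n => ?_
    simp only [Function.comp_apply, div_pow, Real.sq_sqrt (Nat.cast_nonneg n)]
  have hfac : ∀ n, Function.FactorsThrough (fun ω => ((S.R n ω : ℝ) - a * n) / κ n) (S.hist n) :=
    fun n ω ω' h => by simp only [S.factorsThrough_R n h]
  refine satisfiesLDP_of_tendsto_cgf hσ hφ (fun n => measurable_of_factorsThrough (hfac n))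
    (fun n t => integrable_of_factorsThrough (n := n) fun ω ω' h => by
      simp only [S.factorsThrough_R n h]) fun t => ?_
  have hsmall : ∀ᶠ n : ℕ in atTop, |t * (κ n / n)| ≤ θ₀ := by
    have hlim : Tendsto (fun n : ℕ => |t * (κ n / n)|) atTop (nhds 0) := by
      simpa using (hκ1.const_mul t).abs
    exact hlim.eventually_le_const hθ₀
  have herr : Tendsto (fun n : ℕ => C' * (|t| * (κ n)⁻¹ + |t| ^ 3 * (κ n / n))) atTop (nhds 0) := by
    simpa using ((hκ.inv_tendsto_atTop.const_mul |t|).add (hκ1.const_mul (|t| ^ 3))).const_mul C'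
  rw [tendsto_iff_dist_tendsto_zero]
  refine squeeze_zero' (Eventually.of_forall fun _ => dist_nonneg) ?_ herr
  filter_upwards [hsmall, hn0, hκ0] with n hθ hn hk
  have hscale : ProbabilityTheory.cgf (fun ω => ((S.R n ω : ℝ) - a * n) / κ n) S.P
      (t * (κ n ^ 2 / n)) =
      ProbabilityTheory.cgf (fun ω => (S.R n ω : ℝ) - a * n) S.P (t * (κ n / n)) := by
    simp only [ProbabilityTheory.cgf, ProbabilityTheory.mgf]
    congr 2
    ext ω
    congr 1
    field_simp
  have hb := hcgf _ hθ n
  rw [hscale, Real.dist_eq]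
  have hfactor : (κ n ^ 2 / n)⁻¹ *
        ProbabilityTheory.cgf (fun ω => (S.R n ω : ℝ) - a * n) S.P (t * (κ n / n)) -
          t ^ 2 * σ2 / 2 =
      (κ n ^ 2 / n)⁻¹ *
        (ProbabilityTheory.cgf (fun ω => (S.R n ω : ℝ) - a * n) S.P (t * (κ n / n)) -
          n * ((t * (κ n / n)) ^ 2 * σ2 / 2)) := by
    field_simp
  have hpos : 0 < (κ n ^ 2 / n)⁻¹ := by positivity
  rw [hfactor, abs_mul, abs_of_pos hpos]
  refine (mul_le_mul_of_nonneg_left hb hpos.le).trans_eq ?_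
  rw [abs_mul, abs_of_pos (div_pos hk hn)]
  field_simp

end VLMC
end
end

section
/- Under condition [A], for any k, n ∈ ℕ the regeneration times satisfy the exponential tail bound P(τ_k ≥ n) ≤ C e^{−ρn}, where C := 1/(1 − (1−δ1)^{v−1} δ2) and ρ := (1/v) ln C. -/
noncomputable section

open MeasureTheory Filter

namespace VLMC

attribute [local instance] VLMC.mΩ VLMC.hprob

/-- A set of outcomes is determined at time `n` if membership depends only on the characters
appended during the first `n` steps. -/
def DeterminedAt {v : ℕ} {p : ℕ → (Fin (v - 1) → Bool) → ℝ} (S : VLMC v p) (n : ℕ)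
    (A : Set S.Ω) : Prop :=
  ∀ ω₁ ω₂, (∀ i : Fin n, S.X (i.1 + 1) ω₁ = S.X (i.1 + 1) ω₂) → ω₁ ∈ A → ω₂ ∈ A

/-- The outcomes for which the first `n` appended characters are `b`. -/
def cylinder {v : ℕ} {p : ℕ → (Fin (v - 1) → Bool) → ℝ} (S : VLMC v p) (n : ℕ)
    (b : Fin n → Bool) : Set S.Ω :=
  {ω | ∀ i : Fin n, S.X (i.1 + 1) ω = b i}

/-- The chain visits `y₀` at least `k` times, the `k`-th visit being at time `m`. -/
def IsVisit {v : ℕ} {p : ℕ → (Fin (v - 1) → Bool) → ℝ} (S : VLMC v p) :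
    ℕ → ℕ → S.Ω → Prop
  | 0, m, _ => m = 0
  | k + 1, m, ω => ∃ l < m, IsVisit S k l ω ∧ S.hitY0 ω m ∧ ∀ i, l < i → i < m → ¬ S.hitY0 ω i

section

variable {v : ℕ} {p : ℕ → (Fin (v - 1) → Bool) → ℝ} (S : VLMC v p)

lemma cfg_congr {n : ℕ} {ω ω' : S.Ω}
    (h : ∀ i : Fin n, S.X (i.1 + 1) ω = S.X (i.1 + 1) ω') {i : ℤ} (hi : i ≤ n) :
    S.cfg ω i = S.cfg ω' i := by
  rw [S.hcfg, S.hcfg]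
  split_ifs with h0
  · rfl
  · have := h ⟨i.toNat - 1, by omega⟩
    have e : i.toNat - 1 + 1 = i.toNat := by omega
    simpa only [e] using this

lemma cfg_natCast {n : ℕ} (hn : 0 < n) (ω : S.Ω) : S.cfg ω (n : ℤ) = S.X n ω := by
  rw [S.hcfg, if_neg (by omega), Int.toNat_natCast]

lemma mpos_eq_of {n : ℕ} {ω : S.Ω} {m : ℤ} (hm : m ≤ n) (h1 : S.cfg ω m = true)
    (h0 : ∀ i : ℤ, m < i → i ≤ (n : ℤ) → S.cfg ω i = false) : S.mpos ω n = m := by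
  obtain ⟨a, b, c⟩ := S.hmpos ω n
  rcases lt_trichotomy (S.mpos ω n) m with h | h | h
  · simp [c m h hm] at h1
  · exact h
  · simp [h0 _ h a] at b

lemma mpos_congr {n : ℕ} {ω ω' : S.Ω}
    (h : ∀ i : Fin n, S.X (i.1 + 1) ω = S.X (i.1 + 1) ω') :
    S.mpos ω' n = S.mpos ω n := by
  obtain ⟨a, b, c⟩ := S.hmpos ω n
  refine S.mpos_eq_of a ?_ fun i hi hin => ?_
  · rw [← S.cfg_congr h a, b]
  · rw [← S.cfg_congr h hin, c i hi hin]

lemma hitY0_congr {n m : ℕ} (hm : m ≤ n) {ω ω' : S.Ω}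
    (h : ∀ i : Fin n, S.X (i.1 + 1) ω = S.X (i.1 + 1) ω') (hh : S.hitY0 ω m) :
    S.hitY0 ω' m := by
  have h' : ∀ i : Fin m, S.X (i.1 + 1) ω = S.X (i.1 + 1) ω' := fun i => h ⟨i.1, by omega⟩
  refine ⟨(S.mpos_congr h').trans hh.1, fun j => ?_⟩
  rw [← S.cfg_congr h' (by have := j.2; omega), hh.2 j]

lemma hitY0_of_pattern {n : ℕ} {ω : S.Ω} (h0 : ∀ i, i < v - 1 → S.X (n + i + 1) ω = false)
    (h1 : S.X (n + (v - 1) + 1) ω = true) : S.hitY0 ω (n + v) := by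
  have hv := S.hv
  have e : n + (v - 1) + 1 = n + v := by omega
  rw [e] at h1
  refine ⟨S.mpos_eq_of le_rfl ?_ fun i hi hin => by omega, fun j => ?_⟩
  · rw [S.cfg_natCast (by omega), h1]
  · have := h0 j.1 j.2
    rw [← S.cfg_natCast (by omega)] at this
    rw [← this]
    congr 1
    push_cast
    ring

lemma DeterminedAt.mono {S : VLMC v p} {m n : ℕ} (hmn : m ≤ n) {A : Set S.Ω}
    (hA : S.DeterminedAt m A) : S.DeterminedAt n A :=
  fun ω ω' h => hA ω ω' fun i => h ⟨i.1, by omega⟩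

lemma DeterminedAt.inter {S : VLMC v p} {n : ℕ} {A B : Set S.Ω}
    (hA : S.DeterminedAt n A) (hB : S.DeterminedAt n B) : S.DeterminedAt n (A ∩ B) :=
  fun ω ω' h hω => ⟨hA ω ω' h hω.1, hB ω ω' h hω.2⟩

lemma determinedAt_not_hitY0 {m n : ℕ} (hmn : m ≤ n) :
    S.DeterminedAt n {ω | ¬ S.hitY0 ω m} :=
  fun _ _ h hω hit => hω (S.hitY0_congr hmn (fun i => (h i).symm) hit)

lemma measurableSet_cylinder (n : ℕ) (b : Fin n → Bool) : MeasurableSet (S.cylinder n b) := by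
  have : S.cylinder n b = ⋂ i : Fin n, S.X (i.1 + 1) ⁻¹' {b i} := by
    ext ω; simp [cylinder]
  rw [this]
  exact MeasurableSet.iInter fun i => S.hXmeas _ (measurableSet_singleton _)

lemma disjoint_cylinder (n : ℕ) {b c : Fin n → Bool} (h : b ≠ c) :
    Disjoint (S.cylinder n b) (S.cylinder n c) := by
  refine Set.disjoint_left.2 fun ω hb hc => h (funext fun i => ?_)
  rw [← hb i, ← hc i]

open Classical in
lemma DeterminedAt.eq_iUnion {S : VLMC v p} {n : ℕ} {A : Set S.Ω} (hA : S.DeterminedAt n A) :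
    A = ⋃ b ∈ Finset.univ.filter fun b => (S.cylinder n b ∩ A).Nonempty, S.cylinder n b := by
  ext ω
  simp only [Finset.mem_filter, Finset.mem_univ, true_and, Set.mem_iUnion, exists_prop]
  constructor
  · exact fun h => ⟨fun i => S.X (i.1 + 1) ω, ⟨ω, fun _ => rfl, h⟩, fun _ => rfl⟩
  · rintro ⟨b, ⟨ω', h1, h2⟩, h3⟩
    exact hA ω' ω (fun i => (h1 i).trans (h3 i).symm) h2

lemma DeterminedAt.measurableSet {S : VLMC v p} {n : ℕ} {A : Set S.Ω}
    (hA : S.DeterminedAt n A) : MeasurableSet A := by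
  rw [hA.eq_iUnion]
  exact Finset.measurableSet_biUnion _ fun b _ => S.measurableSet_cylinder n b

/-- A lower bound for the transition probabilities on cylinders extends to determined sets. -/
lemma DeterminedAt.le_measureReal_inter {S : VLMC v p} {n : ℕ} {A B : Set S.Ω} {c : ℝ}
    (hA : S.DeterminedAt n A) (hB : MeasurableSet B)
    (h : ∀ b, c * S.P.real (S.cylinder n b) ≤ S.P.real (S.cylinder n b ∩ B)) :
    c * S.P.real A ≤ S.P.real (A ∩ B) := by
  classical
  rw [hA.eq_iUnion, Set.iUnion₂_inter, measureReal_biUnion_finset, measureReal_biUnion_finset,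
    Finset.mul_sum]
  · exact Finset.sum_le_sum fun b _ => h b
  · exact fun b _ c _ hbc => (S.disjoint_cylinder n hbc).mono Set.inter_subset_left
      Set.inter_subset_left
  · exact fun b _ => (S.measurableSet_cylinder n b).inter hB
  · exact fun b _ c _ hbc => S.disjoint_cylinder n hbc
  · exact fun b _ => S.measurableSet_cylinder n b

lemma measurableSet_X (n : ℕ) (c : Bool) : MeasurableSet {ω | S.X n ω = c} :=
  S.hXmeas n (measurableSet_singleton c)

lemma exists_measureReal_cylinder_inter (n : ℕ) (b : Fin n → Bool)
    (hne : (S.cylinder n b).Nonempty) :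
    ∃ k w, S.P.real (S.cylinder n b ∩ {ω | S.X (n + 1) ω = true})
      = max (p k w) 0 * S.P.real (S.cylinder n b) := by
  obtain ⟨ω₀, h₀⟩ := hne
  refine ⟨((n : ℤ) - S.mpos ω₀ n).toNat,
    fun j => S.cfg ω₀ (S.mpos ω₀ n - ((v : ℤ) - 1) + (j.1 : ℤ)), ?_⟩
  have := S.htrans n b ((n : ℤ) - S.mpos ω₀ n).toNat
    (fun j => S.cfg ω₀ (S.mpos ω₀ n - ((v : ℤ) - 1) + (j.1 : ℤ))) (fun ω hω => ?_)
  · have := congrArg ENNReal.toReal this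
    rwa [ENNReal.toReal_mul, ENNReal.toReal_ofReal'] at this
  · have hc : ∀ i : Fin n, S.X (i.1 + 1) ω₀ = S.X (i.1 + 1) ω :=
      fun i => (h₀ i).trans (hω i).symm
    have hle := (S.hmpos ω₀ n).1
    rw [S.mpos_congr hc]
    refine ⟨by omega, fun j => ?_⟩
    rw [S.cfg_congr hc (by have := j.2; omega)]

variable {S} {δ1 δ2 : ℝ}

lemma CondA.le_measureReal_inter_true (hS : S.CondA δ1 δ2) {n : ℕ} {A : Set S.Ω}
    (hA : S.DeterminedAt n A) :
    δ2 * S.P.real A ≤ S.P.real (A ∩ {ω | S.X (n + 1) ω = true}) := by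
  refine hA.le_measureReal_inter (S.measurableSet_X _ _) fun b => ?_
  rcases (S.cylinder n b).eq_empty_or_nonempty with he | hne
  · simp [he]
  · obtain ⟨k, w, h⟩ := S.exists_measureReal_cylinder_inter n b hne
    rw [h]
    gcongr
    exact (hS.2.2.2.2 k w).1.trans (le_max_left _ _)

lemma CondA.le_measureReal_inter_false (hS : S.CondA δ1 δ2) {n : ℕ} {A : Set S.Ω}
    (hA : S.DeterminedAt n A) :
    (1 - δ1) * S.P.real A ≤ S.P.real (A ∩ {ω | S.X (n + 1) ω = false}) := by
  refine hA.le_measureReal_inter (S.measurableSet_X _ _) fun b => ?_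
  rcases (S.cylinder n b).eq_empty_or_nonempty with he | hne
  · simp [he]
  · obtain ⟨k, w, h⟩ := S.exists_measureReal_cylinder_inter n b hne
    have hsum := measureReal_inter_add_sdiff (μ := S.P) (s := S.cylinder n b)
      (S.measurableSet_X (n + 1) true)
    have hd : S.cylinder n b \ {ω | S.X (n + 1) ω = true}
        = S.cylinder n b ∩ {ω | S.X (n + 1) ω = false} := by
      ext ω; simp
    rw [hd, h] at hsum
    have hp : max (p k w) 0 ≤ δ1 :=
      max_le (hS.2.2.2.2 k w).2 (hS.2.1.trans hS.2.2.1).le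
    have := mul_le_mul_of_nonneg_right hp (measureReal_nonneg (μ := S.P) (s := S.cylinder n b))
    linarith

lemma determinedAt_inter_zeros {n : ℕ} {A : Set S.Ω} (hA : S.DeterminedAt n A) (j : ℕ) :
    S.DeterminedAt (n + j) (A ∩ {ω | ∀ i, i < j → S.X (n + i + 1) ω = false}) := by
  intro ω ω' h hω
  refine ⟨hA.mono (Nat.le_add_right n j) ω ω' h hω.1, fun i hi => ?_⟩
  rw [← h ⟨n + i, by omega⟩, hω.2 i hi]

lemma CondA.le_measureReal_inter_zeros (hS : S.CondA δ1 δ2) {n : ℕ} {A : Set S.Ω}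
    (hA : S.DeterminedAt n A) (j : ℕ) :
    (1 - δ1) ^ j * S.P.real A
      ≤ S.P.real (A ∩ {ω | ∀ i, i < j → S.X (n + i + 1) ω = false}) := by
  induction j with
  | zero => simp
  | succ j ih =>
    have hδ : 0 ≤ 1 - δ1 := by linarith [hS.2.2.2.1]
    have h := hS.le_measureReal_inter_false (determinedAt_inter_zeros hA j)
    have hset : A ∩ {ω | ∀ i, i < j → S.X (n + i + 1) ω = false} ∩
        {ω | S.X (n + j + 1) ω = false}
        = A ∩ {ω | ∀ i, i < j + 1 → S.X (n + i + 1) ω = false} := by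
      ext ω
      simp only [Set.mem_inter_iff, Set.mem_ofPred_eq, Nat.forall_lt_succ_right, and_assoc]
    rw [hset] at h
    calc (1 - δ1) ^ (j + 1) * S.P.real A = (1 - δ1) * ((1 - δ1) ^ j * S.P.real A) := by ring
      _ ≤ _ := (mul_le_mul_of_nonneg_left ih hδ).trans h

lemma CondA.measureReal_inter_not_hitY0_le (hS : S.CondA δ1 δ2) {n : ℕ} {A : Set S.Ω}
    (hA : S.DeterminedAt n A) :
    S.P.real (A ∩ {ω | ¬ S.hitY0 ω (n + v)})
      ≤ (1 - (1 - δ1) ^ (v - 1) * δ2) * S.P.real A := by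
  have h0 := hS.le_measureReal_inter_zeros hA (v - 1)
  have h1 := hS.le_measureReal_inter_true (determinedAt_inter_zeros hA (v - 1))
  set B := A ∩ {ω | ∀ i, i < v - 1 → S.X (n + i + 1) ω = false} ∩
    {ω | S.X (n + (v - 1) + 1) ω = true}
  have hsub : B ⊆ A := fun ω h => h.1.1
  have hBm : MeasurableSet B :=
    (determinedAt_inter_zeros hA (v - 1)).measurableSet.inter (S.measurableSet_X _ _)
  have hle : S.P.real (A ∩ {ω | ¬ S.hitY0 ω (n + v)}) ≤ S.P.real (A \ B) :=
    measureReal_mono fun ω h => ⟨h.1, fun hb => h.2 (S.hitY0_of_pattern hb.1.2 hb.2)⟩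
  rw [measureReal_sdiff hsub hBm] at hle
  have := mul_le_mul_of_nonneg_left h0 hS.2.1.le
  linarith

lemma CondA.missProb_pos (hS : S.CondA δ1 δ2) : 0 < 1 - (1 - δ1) ^ (v - 1) * δ2 := by
  obtain ⟨-, h2, h21, h1, -⟩ := hS
  have hle : (1 - δ1) ^ (v - 1) ≤ 1 := pow_le_one₀ (by linarith) (by linarith)
  have := mul_le_mul_of_nonneg_right hle h2.le
  linarith

lemma CondA.missProb_lt_one (hS : S.CondA δ1 δ2) : 1 - (1 - δ1) ^ (v - 1) * δ2 < 1 :=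
  sub_lt_self _ (mul_pos (pow_pos (sub_pos.2 hS.2.2.2.1) _) hS.2.1)

/-- Whatever happened up to time `n`, the chain misses `y₀` during the next `j * v` steps with
probability at most `(1 - (1 - δ1) ^ (v - 1) * δ2) ^ j`. -/
lemma CondA.measureReal_inter_forall_not_hitY0_le (hS : S.CondA δ1 δ2) {n : ℕ} {A : Set S.Ω}
    (hA : S.DeterminedAt n A) (j : ℕ) :
    S.P.real (A ∩ {ω | ∀ i, n < i → i ≤ n + j * v → ¬ S.hitY0 ω i})
      ≤ (1 - (1 - δ1) ^ (v - 1) * δ2) ^ j * S.P.real A := by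
  induction j with
  | zero =>
    simpa using measureReal_mono (μ := S.P) Set.inter_subset_left
  | succ j ih =>
    have hdet : S.DeterminedAt (n + j * v)
        (A ∩ {ω | ∀ i, n < i → i ≤ n + j * v → ¬ S.hitY0 ω i}) :=
      (hA.mono (Nat.le_add_right _ _)).inter fun ω ω' h hω i hi hin =>
        S.determinedAt_not_hitY0 hin ω ω' h (hω i hi hin)
    have hsub : A ∩ {ω | ∀ i, n < i → i ≤ n + (j + 1) * v → ¬ S.hitY0 ω i} ⊆
        A ∩ {ω | ∀ i, n < i → i ≤ n + j * v → ¬ S.hitY0 ω i} ∩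
          {ω | ¬ S.hitY0 ω (n + j * v + v)} := by
      have hv := S.hv
      rintro ω ⟨hωA, hω⟩
      exact ⟨⟨hωA, fun i hi hin => hω i hi (by rw [add_one_mul]; omega)⟩,
        hω _ (by omega) (by rw [add_one_mul]; omega)⟩
    calc S.P.real (A ∩ {ω | ∀ i, n < i → i ≤ n + (j + 1) * v → ¬ S.hitY0 ω i})
      _ ≤ (1 - (1 - δ1) ^ (v - 1) * δ2) *
          S.P.real (A ∩ {ω | ∀ i, n < i → i ≤ n + j * v → ¬ S.hitY0 ω i}) :=
        (measureReal_mono hsub).trans (hS.measureReal_inter_not_hitY0_le hdet)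
      _ ≤ (1 - (1 - δ1) ^ (v - 1) * δ2) *
          ((1 - (1 - δ1) ^ (v - 1) * δ2) ^ j * S.P.real A) :=
        mul_le_mul_of_nonneg_left ih hS.missProb_pos.le
      _ = _ := by ring

lemma CondA.ae_exists_hitY0 (hS : S.CondA δ1 δ2) :
    ∀ᵐ ω ∂S.P, ∀ m, ∃ i, m < i ∧ S.hitY0 ω i := by
  refine ae_all_iff.2 fun m => ?_
  have huniv : S.DeterminedAt m Set.univ := fun _ _ _ _ => trivial
  have hlim := tendsto_pow_atTop_nhds_zero_of_lt_one hS.missProb_pos.le hS.missProb_lt_one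
  have hle : S.P.real {ω | ¬ ∃ i, m < i ∧ S.hitY0 ω i} ≤ 0 := by
    refine ge_of_tendsto' hlim fun j => ?_
    have h := hS.measureReal_inter_forall_not_hitY0_le huniv j
    rw [probReal_univ, mul_one] at h
    refine (measureReal_mono ?_).trans h
    exact fun ω hω => ⟨trivial, fun i hi _ hit => hω ⟨i, hi, hit⟩⟩
  exact (measureReal_eq_zero_iff).1 (le_antisymm hle measureReal_nonneg)

lemma IsVisit.T_eq {k m : ℕ} {ω : S.Ω} (h : S.IsVisit k m ω) : S.T k ω = m := by
  induction k generalizing m with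
  | zero => exact h.symm
  | succ k ih =>
    obtain ⟨l, hlm, hl, hit, hno⟩ := h
    rw [T, ih hl]
    exact IsLeast.csInf_eq ⟨⟨hlm, hit⟩, fun i hi => not_lt.1 fun him => hno i hi.1 him hi.2⟩

lemma isVisit_T {ω : S.Ω} (h : ∀ m, ∃ i, m < i ∧ S.hitY0 ω i) (k : ℕ) :
    S.IsVisit k (S.T k ω) ω := by
  induction k with
  | zero => rfl
  | succ k ih =>
    have hmem : S.T (k + 1) ω ∈ {n | S.T k ω < n ∧ S.hitY0 ω n} := Nat.sInf_mem (h _)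
    exact ⟨S.T k ω, hmem.1, ih, hmem.2, fun i hi him hit => Nat.notMem_of_lt_sInf him ⟨hi, hit⟩⟩

variable (S) in
lemma determinedAt_isVisit (k m : ℕ) : S.DeterminedAt m {ω | S.IsVisit k m ω} := by
  induction k generalizing m with
  | zero => exact fun _ _ _ h => h
  | succ k ih =>
    rintro ω ω' h ⟨l, hlm, hl, hit, hno⟩
    exact ⟨l, hlm, (ih l).mono hlm.le ω ω' h hl, S.hitY0_congr le_rfl h hit,
      fun i hi him => S.determinedAt_not_hitY0 him.le ω ω' h (hno i hi him)⟩

lemma CondA.measure_le_tau_le (hS : S.CondA δ1 δ2) (k : ℕ) {n j : ℕ} (hj : j * v < n) :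
    S.P {ω | n ≤ S.tau (k + 1) ω} ≤ ENNReal.ofReal ((1 - (1 - δ1) ^ (v - 1) * δ2) ^ j) := by
  set q := 1 - (1 - δ1) ^ (v - 1) * δ2
  have hq0 : 0 ≤ q := hS.missProb_pos.le
  have hsub : {ω | n ≤ S.tau (k + 1) ω} ≤ᵐ[S.P] ⋃ m, ({ω | S.IsVisit k m ω} ∩
      {ω | ∀ i, m < i → i ≤ m + j * v → ¬ S.hitY0 ω i} : Set S.Ω) := by
    filter_upwards [hS.ae_exists_hitY0] with ω hω hn
    refine Set.mem_iUnion.2 ⟨S.T k ω, isVisit_T hω k, fun i hi hij hit => ?_⟩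
    have hle : S.T (k + 1) ω ≤ i := Nat.sInf_le ⟨hi, hit⟩
    have hn : n ≤ S.T (k + 1) ω - S.T k ω := hn
    omega
  have hterm (m : ℕ) : S.P ({ω | S.IsVisit k m ω} ∩
      {ω | ∀ i, m < i → i ≤ m + j * v → ¬ S.hitY0 ω i}) ≤
      ENNReal.ofReal (q ^ j) * S.P {ω | S.IsVisit k m ω} := by
    have h := hS.measureReal_inter_forall_not_hitY0_le (S.determinedAt_isVisit k m) j
    rw [← ofReal_measureReal, ← ofReal_measureReal, ← ENNReal.ofReal_mul (by positivity)]
    exact ENNReal.ofReal_le_ofReal h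
  have hdisj : Pairwise (Function.onFun Disjoint fun m => {ω | S.IsVisit k m ω}) :=
    fun m m' hmm => Set.disjoint_left.2 fun ω h h' =>
      hmm ((IsVisit.T_eq h).symm.trans (IsVisit.T_eq h'))
  calc S.P {ω | n ≤ S.tau (k + 1) ω}
    _ ≤ ∑' m, S.P ({ω | S.IsVisit k m ω} ∩
          {ω | ∀ i, m < i → i ≤ m + j * v → ¬ S.hitY0 ω i}) :=
      (measure_mono_ae hsub).trans (measure_iUnion_le _)
    _ ≤ ∑' m, ENNReal.ofReal (q ^ j) * S.P {ω | S.IsVisit k m ω} := ENNReal.tsum_le_tsum hterm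
    _ = ENNReal.ofReal (q ^ j) * S.P (⋃ m, {ω | S.IsVisit k m ω}) := by
      rw [ENNReal.tsum_mul_left,
        measure_iUnion hdisj fun m => (S.determinedAt_isVisit k m).measurableSet]
    _ ≤ ENNReal.ofReal (q ^ j) := mul_le_of_le_one_right' prob_le_one

end

lemma pow_le_one_div_mul_exp {q : ℝ} (h0 : 0 < q) (h1 : q < 1) {v n j : ℕ} (hv : 0 < v)
    (hj : n ≤ (j + 1) * v) :
    q ^ j ≤ 1 / q * Real.exp (-((1 : ℝ) / v * Real.log (1 / q)) * n) := by
  have hv' : (0 : ℝ) < v := by exact_mod_cast hv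
  have hj' : (n : ℝ) / v - 1 ≤ j := by
    rw [sub_le_iff_le_add, div_le_iff₀ hv']
    exact_mod_cast hj
  have hlog := Real.log_neg h0 h1
  calc q ^ j = Real.exp (j * Real.log q) := by
        rw [Real.exp_nat_mul, Real.exp_log h0]
    _ ≤ Real.exp (-Real.log q + -((1 : ℝ) / v * -Real.log q) * n) := by
        refine Real.exp_le_exp.2 ((mul_le_mul_of_nonpos_right hj' hlog.le).trans_eq ?_)
        ring
    _ = _ := by
        rw [Real.exp_add, Real.exp_neg, Real.exp_log h0, one_div q, Real.log_inv]

/-- Lemma 4.1: under condition [A], for all `k, n ∈ ℕ`,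
`P(τ_k ≥ n) ≤ C e^{-ρ n}`, where `C = 1/(1 - (1-δ1)^{v-1} δ2)` and
`ρ = (1/v) ln C`. -/
theorem statement5 {v : ℕ} {p : ℕ → (Fin (v - 1) → Bool) → ℝ} (S : VLMC v p)
    (δ1 δ2 : ℝ) (hA : S.CondA δ1 δ2)
    (k n : ℕ) (hk : 1 ≤ k) (hn : 1 ≤ n) :
    S.P {ω | n ≤ S.tau k ω} ≤
      ENNReal.ofReal ((1 / (1 - (1 - δ1) ^ (v - 1) * δ2)) *
        Real.exp (-(((1 : ℝ) / v) * Real.log (1 / (1 - (1 - δ1) ^ (v - 1) * δ2))) * n)) := by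
  obtain ⟨k, rfl⟩ := Nat.exists_eq_add_of_le' hk
  have hv := S.hv
  have hdiv := Nat.div_add_mod (n - 1) v
  have hmod := Nat.mod_lt (n - 1) hv
  rw [mul_comm] at hdiv
  refine (hA.measure_le_tau_le k (j := (n - 1) / v) (by omega)).trans
    (ENNReal.ofReal_le_ofReal ?_)
  exact pow_le_one_div_mul_exp hA.missProb_pos hA.missProb_lt_one hv
    (by rw [add_one_mul]; omega)

end VLMC
end
end
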